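/- For every fixed local dimension d there is a constant C (depending only on d) such that: for every 2-local Hamiltonian H = ∑_{e∈E} h_e on n qudits of local dimension d and every integer 1 ≤ l ≤ n, there exists a separable state σ such that f(σ) ≥ F ≥ f(σ) − C·( (l/n)·|J|_1 + (n/√l)·‖J‖_F ), where J is the array of interaction strengths J_e = ‖h_e‖_∞. -/

import Mathlib

open scoped BigOperators ComplexOrder

noncomputable section

namespace QLH

/-- The operator (spectral) norm of a square complex matrix. -/
def opNorm {m : Type*} [Fintype m] [DecidableEq m] (A : Matrix m m ℂ) : ℝ :=
  ‖Matrix.toEuclideanCLM (𝕜 := ℂ) A‖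

/-- A density matrix: positive semidefinite with unit trace. -/
def IsDensity {m : Type*} [Fintype m] (ρ : Matrix m m ℂ) : Prop :=
  ρ.PosSemidef ∧ ρ.trace = 1

/-- The (real) energy `Tr[Hρ]`. -/
def energy {m : Type*} [Fintype m] (H ρ : Matrix m m ℂ) : ℝ :=
  ((H * ρ).trace).re

/-- Von Neumann entropy via eigenvalues. -/
def entropy {m : Type*} [Fintype m] [DecidableEq m] (ρ : Matrix m m ℂ) : ℝ :=
  if h : ρ.IsHermitian then -∑ i, h.eigenvalues i * Real.log (h.eigenvalues i) else 0

/-- The free-energy functional at inverse temperature `β`. -/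
def freeEnergyFun {m : Type*} [Fintype m] [DecidableEq m] (β : ℝ) (H ρ : Matrix m m ℂ) : ℝ :=
  energy H ρ - entropy ρ / β

/-- The free energy: the infimum of the free-energy functional over density matrices. -/
def freeEnergy {m : Type*} [Fintype m] [DecidableEq m] (β : ℝ) (H : Matrix m m ℂ) : ℝ :=
  sInf {x : ℝ | ∃ ρ, IsDensity ρ ∧ x = freeEnergyFun β H ρ}

/-- `A` acts (nontrivially) only on the sites in `e`. -/
def ActsOn {n : ℕ} {α : Type*} [Fintype α] [DecidableEq α]
    (A : Matrix (Fin n → α) (Fin n → α) ℂ) (e : Finset (Fin n)) : Prop :=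
  ∃ M : Matrix ({u // u ∈ e} → α) ({u // u ∈ e} → α) ℂ,
    ∀ x y, A x y =
      (if ∀ u ∉ e, x u = y u then (1 : ℂ) else 0) *
        M (fun u => x u.1) (fun u => y u.1)

/-- Tensor-product (product) state built from single-site matrices. -/
def prodState {n : ℕ} {α : Type*} [Fintype α] (σ : Fin n → Matrix α α ℂ) :
    Matrix (Fin n → α) (Fin n → α) ℂ :=
  fun x y => ∏ u, σ u (x u) (y u)

/-- A separable state: a finite convex combination of product states. -/
def IsSeparable {n : ℕ} {α : Type*} [Fintype α] [DecidableEq α]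
    (σ : Matrix (Fin n → α) (Fin n → α) ℂ) : Prop :=
  ∃ (N : ℕ) (p : Fin N → ℝ) (τ : Fin N → Fin n → Matrix α α ℂ),
    (∀ i, 0 ≤ p i) ∧ (∑ i, p i = 1) ∧ (∀ i u, IsDensity (τ i u)) ∧
    σ = ∑ i, (p i : ℂ) • prodState (τ i)

section LinAlg

variable {m : Type*} [Fintype m] [DecidableEq m]

open Matrix

lemma spec (A : Matrix m m ℂ) (hA : A.IsHermitian) :
    A = (hA.eigenvectorUnitary : Matrix m m ℂ) * diagonal (fun i => (hA.eigenvalues i : ℂ)) *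
      (hA.eigenvectorUnitary : Matrix m m ℂ)ᴴ := by
  conv_lhs => rw [hA.spectral_theorem]
  rw [Unitary.conjStarAlgAut_apply]
  rfl

lemma unit_left (A : Matrix m m ℂ) (hA : A.IsHermitian) :
    (hA.eigenvectorUnitary : Matrix m m ℂ)ᴴ * (hA.eigenvectorUnitary : Matrix m m ℂ) = 1 :=
  Unitary.coe_star_mul_self _

lemma unit_comm {V : Matrix m m ℂ} (h : Vᴴ * V = 1) : V * Vᴴ = 1 :=
  mul_eq_one_comm.mp h

section
open scoped Matrix.Norms.L2Operator

lemma opNorm_eq (A : Matrix m m ℂ) : opNorm A = ‖A‖ := rfl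

lemma opNorm_nonneg (A : Matrix m m ℂ) : 0 ≤ opNorm A := by
  rw [opNorm_eq]; exact norm_nonneg _

lemma entry_le (A : Matrix m m ℂ) (i j : m) : ‖A i j‖ ≤ opNorm A := by
  have h := Matrix.l2_opNorm_mulVec A (EuclideanSpace.single j (1 : ℂ))
  have h2 : ‖(EuclideanSpace.single j (1 : ℂ))‖ = 1 := by simp
  rw [h2, mul_one] at h
  refine le_trans ?_ h
  have h3 := PiLp.norm_apply_le (WithLp.toLp 2 (A *ᵥ (EuclideanSpace.single j (1 : ℂ)).ofLp) : EuclideanSpace ℂ m) i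
  refine le_trans (le_of_eq ?_) h3
  simp

lemma unit_norm_le {V : Matrix m m ℂ} (h : Vᴴ * V = 1) : ‖V‖ ≤ 1 := by
  by_cases hn : Nonempty m
  · have h1 := Matrix.l2_opNorm_conjTranspose_mul_self V
    rw [h, norm_one] at h1
    nlinarith [norm_nonneg V]
  · have : V = 0 := by
      ext i; exact (hn ⟨i⟩).elim
    rw [this]; simp

lemma trace_le (A ρ : Matrix m m ℂ) (hρ : IsDensity ρ) : ‖(A * ρ).trace‖ ≤ opNorm A := by
  have hH := hρ.1.isHermitian
  set U : Matrix m m ℂ := (hH.eigenvectorUnitary : Matrix m m ℂ) with hU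
  have hU1 : Uᴴ * U = 1 := unit_left ρ hH
  have e1 : (A * ρ).trace = ∑ j, (Uᴴ * A * U) j j * (hH.eigenvalues j : ℂ) := by
    conv_lhs => rw [spec ρ hH]
    rw [← hU, ← mul_assoc, Matrix.trace_mul_comm, ← mul_assoc, ← mul_assoc]
    simp [Matrix.trace]
  have hs : ∑ j, hH.eigenvalues j = 1 := by
    have := hH.trace_eq_sum_eigenvalues
    rw [hρ.2] at this
    simpa using (congrArg Complex.re this).symm
  rw [e1]
  calc _ ≤ ∑ j, ‖(Uᴴ * A * U) j j * (hH.eigenvalues j : ℂ)‖ := norm_sum_le _ _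
    _ ≤ ∑ j, opNorm A * hH.eigenvalues j := by
        refine Finset.sum_le_sum fun j _ => ?_
        rw [norm_mul, Complex.norm_real, Real.norm_of_nonneg (hρ.1.eigenvalues_nonneg j)]
        refine mul_le_mul_of_nonneg_right ?_ (hρ.1.eigenvalues_nonneg j)
        refine (entry_le _ j j).trans ?_
        rw [opNorm_eq, opNorm_eq]
        have h1 := unit_norm_le hU1
        have h2 : ‖Uᴴ‖ ≤ 1 := by rw [Matrix.l2_opNorm_conjTranspose]; exact h1
        calc ‖Uᴴ * A * U‖ ≤ ‖Uᴴ * A‖ * ‖U‖ := norm_mul_le _ _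
          _ ≤ ‖Uᴴ‖ * ‖A‖ * ‖U‖ := by gcongr; exact norm_mul_le _ _
          _ ≤ 1 * ‖A‖ * 1 := by gcongr
          _ = ‖A‖ := by ring
    _ = opNorm A := by rw [← Finset.mul_sum, hs, mul_one]
end

lemma energy_le (A ρ : Matrix m m ℂ) (hρ : IsDensity ρ) : |energy A ρ| ≤ opNorm A :=
  (Complex.abs_re_le_norm _).trans (trace_le A ρ hρ)

lemma herm_conj (V : Matrix m m ℂ) (s : m → ℝ) :
    (V * diagonal (fun i => (s i : ℂ)) * Vᴴ).IsHermitian := by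
  unfold Matrix.IsHermitian
  rw [conjTranspose_mul, conjTranspose_mul, conjTranspose_conjTranspose, diagonal_conjTranspose,
    mul_assoc]
  congr 3
  ext i; simp

lemma entropy_diag {V : Matrix m m ℂ} (h : Vᴴ * V = 1) (s : m → ℝ) :
    entropy (V * diagonal (fun i => (s i : ℂ)) * Vᴴ) = - ∑ k, s k * Real.log (s k) := by
  have hH := herm_conj V s
  unfold entropy
  rw [dif_pos hH]
  congr 1
  have h1 := hH.roots_charpoly_eq_eigenvalues
  have h2 : (V * diagonal (fun i => (s i : ℂ)) * Vᴴ).charpoly =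
      (diagonal (fun i => (s i : ℂ))).charpoly := by
    rw [Matrix.charpoly_mul_comm, ← mul_assoc, h, one_mul]
  rw [h2, Matrix.charpoly_diagonal] at h1
  have h3 : (∏ i, (Polynomial.X - Polynomial.C ((s i : ℝ) : ℂ))).roots =
      Multiset.map (fun i => ((s i : ℝ) : ℂ)) Finset.univ.val := by
    rw [Finset.prod_eq_multiset_prod]
    have := Polynomial.roots_multiset_prod_X_sub_C
      (Multiset.map (fun i => ((s i : ℝ) : ℂ)) Finset.univ.val)
    rw [Multiset.map_map] at this
    exact this
  rw [h3] at h1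
  have h4 := congrArg (fun M => (Multiset.map (fun z : ℂ => z.re * Real.log z.re) M).sum) h1
  simp only [Multiset.map_map] at h4
  exact h4.symm

lemma density_diag {V : Matrix m m ℂ} (h : Vᴴ * V = 1) (s : m → ℝ) (hs : ∀ k, 0 ≤ s k)
    (h1 : ∑ k, s k = 1) : IsDensity (V * diagonal (fun i => (s i : ℂ)) * Vᴴ) := by
  constructor
  · apply PosSemidef.mul_mul_conjTranspose_same
    apply PosSemidef.diagonal
    intro i; simp [hs i]
  · rw [Matrix.trace_mul_comm, ← mul_assoc, h, one_mul, trace_diagonal]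
    exact_mod_cast h1

/-- pointwise inequality -/
lemma klein_pt {r s : ℝ} (hr : 0 ≤ r) (hs : 0 < s) :
    r - s ≤ r * Real.log r - r * Real.log s := by
  rcases hr.eq_or_lt with h | h
  · subst h; simp; exact hs.le
  · have := Real.log_le_sub_one_of_pos (div_pos hs h)
    rw [Real.log_div hs.ne' h.ne'] at this
    have h2 := mul_le_mul_of_nonneg_left this hr
    have h3 : r * (s / r - 1) = s - r := by field_simp
    rw [h3] at h2
    linarith

lemma klein {ρ V : Matrix m m ℂ} (hρ : IsDensity ρ) (hV : Vᴴ * V = 1) (s : m → ℝ)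
    (hs : ∀ k, 0 ≤ s k) (hs1 : ∑ k, s k = 1)
    (h0 : ∀ k, s k = 0 → ((Vᴴ * ρ * V) k k).re = 0) :
    entropy ρ ≤ - ∑ k, ((Vᴴ * ρ * V) k k).re * Real.log (s k) := by
  have hH := hρ.1.isHermitian
  set U : Matrix m m ℂ := (hH.eigenvectorUnitary : Matrix m m ℂ) with hU
  have hU1 : Uᴴ * U = 1 := unit_left ρ hH
  set r := hH.eigenvalues with hr
  have hr0 : ∀ j, 0 ≤ r j := hρ.1.eigenvalues_nonneg
  have hr1 : ∑ j, r j = 1 := by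
    have := hH.trace_eq_sum_eigenvalues
    rw [hρ.2] at this
    simpa using (congrArg Complex.re this).symm
  set W := Vᴴ * U with hW
  have hWW : W * Wᴴ = 1 := by
    rw [hW, conjTranspose_mul, conjTranspose_conjTranspose, ← mul_assoc, mul_assoc Vᴴ, unit_comm hU1,
      mul_one, hV]
  have hWW' : Wᴴ * W = 1 := mul_eq_one_comm.mp hWW
  have q_eq : ∀ k, ((Vᴴ * ρ * V) k k).re = ∑ j, Complex.normSq (W k j) * r j := by
    intro k
    have : Vᴴ * ρ * V = W * diagonal (fun i => (r i : ℂ)) * Wᴴ := by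
      conv_lhs => rw [spec ρ hH]
      rw [hW, conjTranspose_mul, conjTranspose_conjTranspose]
      simp only [mul_assoc]
      rfl
    rw [this, Matrix.mul_apply, Complex.re_sum]
    refine Finset.sum_congr rfl fun j _ => ?_
    rw [Matrix.mul_diagonal, conjTranspose_apply]
    simp [Complex.normSq_apply]; ring
  have row : ∀ k, ∑ j, Complex.normSq (W k j) = 1 := by
    intro k
    have := congrArg Complex.re (congrFun (congrFun hWW k) k)
    rw [Matrix.mul_apply, Complex.re_sum, Matrix.one_apply_eq, Complex.one_re] at this
    rw [← this]
    refine Finset.sum_congr rfl fun j _ => ?_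
    rw [conjTranspose_apply]; simp [Complex.normSq_apply]
  have col : ∀ j, ∑ k, Complex.normSq (W k j) = 1 := by
    intro j
    have := congrArg Complex.re (congrFun (congrFun hWW' j) j)
    rw [Matrix.mul_apply, Complex.re_sum, Matrix.one_apply_eq, Complex.one_re] at this
    rw [← this]
    refine Finset.sum_congr rfl fun j _ => ?_
    rw [conjTranspose_apply]; simp [Complex.normSq_apply]
  have key : ∀ k j, Complex.normSq (W k j) * (r j - s k) ≤
      Complex.normSq (W k j) * (r j * Real.log (r j) - r j * Real.log (s k)) := by
    intro k j
    rcases (hs k).eq_or_lt with h | h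
    · have h1 := h0 k h.symm
      rw [q_eq, Finset.sum_eq_zero_iff_of_nonneg
        (fun j _ => mul_nonneg (Complex.normSq_nonneg _) (hr0 j))] at h1
      have h2 := h1 j (Finset.mem_univ _)
      rw [← h]
      simp only [Real.log_zero, mul_zero, sub_zero, ← mul_assoc, h2, zero_mul, le_refl]
    · exact mul_le_mul_of_nonneg_left (klein_pt (hr0 j) h) (Complex.normSq_nonneg _)
  have sum := Finset.sum_le_sum fun k (_ : k ∈ Finset.univ) =>
    Finset.sum_le_sum fun j (_ : j ∈ Finset.univ) => key k j
  have L : ∑ k, ∑ j, Complex.normSq (W k j) * (r j - s k) = 0 := by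
    simp only [mul_sub, Finset.sum_sub_distrib]
    rw [Finset.sum_comm]
    simp only [← Finset.sum_mul, row, col, one_mul, hr1, hs1, sub_self]
  have R : ∑ k, ∑ j, Complex.normSq (W k j) * (r j * Real.log (r j) - r j * Real.log (s k)) =
      ∑ j, r j * Real.log (r j) - ∑ k, ((Vᴴ * ρ * V) k k).re * Real.log (s k) := by
    simp only [mul_sub, Finset.sum_sub_distrib]
    congr 1
    · rw [Finset.sum_comm]
      simp only [← Finset.sum_mul, col, one_mul]
    · refine Finset.sum_congr rfl fun k _ => ?_
      rw [q_eq, Finset.sum_mul]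
      refine Finset.sum_congr rfl fun j _ => ?_
      ring
  rw [L, R] at sum
  unfold entropy
  rw [dif_pos hH]
  linarith

lemma gibbs [Nonempty m] (H : Matrix m m ℂ) (hH : H.IsHermitian) :
    ∃ ρ, IsDensity ρ ∧ ∀ ω, IsDensity ω → freeEnergyFun 1 H ρ ≤ freeEnergyFun 1 H ω := by
  set U : Matrix m m ℂ := (hH.eigenvectorUnitary : Matrix m m ℂ) with hU
  have hU1 : Uᴴ * U = 1 := unit_left H hH
  set ev := hH.eigenvalues with hev
  set Z := ∑ k, Real.exp (- ev k) with hZ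
  have hZ0 : 0 < Z := Finset.sum_pos (fun k _ => Real.exp_pos _) Finset.univ_nonempty
  set s : m → ℝ := fun k => Real.exp (- ev k) / Z with hs
  have hs0 : ∀ k, 0 < s k := fun k => div_pos (Real.exp_pos _) hZ0
  have hs1 : ∑ k, s k = 1 := by
    rw [hs, ← Finset.sum_div, ← hZ, div_self hZ0.ne']
  have hlog : ∀ k, Real.log (s k) = - ev k - Real.log Z := by
    intro k
    rw [hs]; simp only
    rw [Real.log_div (Real.exp_pos _).ne' hZ0.ne', Real.log_exp]
  have hen : ∀ ω : Matrix m m ℂ, energy H ω = ∑ k, ev k * ((Uᴴ * ω * U) k k).re := by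
    intro ω
    unfold energy
    conv_lhs => rw [spec H hH]
    rw [← hU, mul_assoc, mul_assoc, Matrix.trace_mul_comm, mul_assoc]
    simp [Matrix.trace]
    rfl
  have hD := density_diag hU1 s (fun k => (hs0 k).le) hs1
  have htr : ∀ ω : Matrix m m ℂ, IsDensity ω → ∑ k, ((Uᴴ * ω * U) k k).re = 1 := by
    intro ω hω
    have h : (Uᴴ * ω * U).trace = 1 := by
      rw [Matrix.trace_mul_comm, ← mul_assoc, unit_comm hU1, one_mul, hω.2]
    have := congrArg Complex.re h
    rw [Matrix.trace, Complex.re_sum] at this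
    simpa using this
  refine ⟨_, hD, fun ω hω => ?_⟩
  have hk := klein hω hU1 s (fun k => (hs0 k).le) hs1 (fun k h => absurd h (hs0 k).ne')
  have e1 : freeEnergyFun 1 H (U * diagonal (fun i => (s i : ℂ)) * Uᴴ) = - Real.log Z := by
    unfold freeEnergyFun
    rw [hen, entropy_diag hU1, div_one]
    have : Uᴴ * (U * diagonal (fun i => (s i : ℂ)) * Uᴴ) * U = diagonal (fun i => (s i : ℂ)) := by
      rw [← mul_assoc, ← mul_assoc, hU1, one_mul, mul_assoc, hU1, mul_one]
    rw [this]
    simp only [diagonal_apply_eq, Complex.ofReal_re, hlog]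
    rw [sub_neg_eq_add, ← Finset.sum_add_distrib]
    have : ∀ k, ev k * s k + s k * (-ev k - Real.log Z) = s k * (- Real.log Z) := by intro k; ring
    simp only [this]
    rw [← Finset.sum_mul, hs1, one_mul]
  rw [e1]
  unfold freeEnergyFun
  rw [hen, div_one]
  have e2 : - ∑ k, ((Uᴴ * ω * U) k k).re * Real.log (s k) =
      ∑ k, ev k * ((Uᴴ * ω * U) k k).re + Real.log Z := by
    rw [← one_mul (Real.log Z), ← htr ω hω, Finset.sum_mul, ← Finset.sum_add_distrib,
      ← Finset.sum_neg_distrib]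
    refine Finset.sum_congr rfl fun k _ => ?_
    rw [hlog]; ring
  linarith

lemma trace_mul_nonneg {A B : Matrix m m ℂ} (hA : A.PosSemidef) (hB : B.PosSemidef) :
    0 ≤ (A * B).trace := by
  have hH := hA.isHermitian
  rw [spec A hH, mul_assoc, mul_assoc, Matrix.trace_mul_comm, mul_assoc]
  have h2 := hB.conjTranspose_mul_mul_same (hH.eigenvectorUnitary : Matrix m m ℂ)
  simp only [Matrix.trace, diag_apply, diagonal_mul]
  refine Finset.sum_nonneg fun k _ => mul_nonneg ?_ h2.diag_nonneg
  simpa using hA.eigenvalues_nonneg k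

end LinAlg

section Prod

open Matrix Function

variable {n d : ℕ}

/-- local matrices -/
abbrev Mat (d : ℕ) := Matrix (Fin d) (Fin d) ℂ

/-- configurations -/
abbrev Cfg (n d : ℕ) := Fin n → Fin d

/-- the multilinear functional `a ↦ Tr[(⊗ a_u) ρ]` -/
def Lf (ρ : Matrix (Cfg n d) (Cfg n d) ℂ) :
    MultilinearMap ℂ (fun _ : Fin n => Mat d) ℂ :=
  ∑ x : Cfg n d, ∑ y : Cfg n d, ρ y x •
    (MultilinearMap.mkPiAlgebra ℂ (Fin n) ℂ).compLinearMap
      (fun u => Matrix.entryLinearMap ℂ ℂ (x u) (y u))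

lemma Lf_apply (ρ : Matrix (Cfg n d) (Cfg n d) ℂ) (a : Fin n → Mat d) :
    Lf ρ a = (prodState a * ρ).trace := by
  simp [Lf, Matrix.trace, Matrix.mul_apply, prodState, mul_comm]

lemma sum_cfg_prod (f : Fin n → Fin d → ℂ) : ∑ x : Cfg n d, ∏ u, f u (x u) = ∏ u, ∑ i, f u i := by
  rw [Finset.prod_univ_sum, Fintype.piFinset_univ]

lemma prodState_mul (a b : Fin n → Mat d) :
    prodState a * prodState b = prodState (fun u => a u * b u) := by
  ext x y
  simp only [Matrix.mul_apply, prodState, ← Finset.prod_mul_distrib]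
  exact sum_cfg_prod (fun u i => a u (x u) i * b u i (y u))

lemma prodState_trace (a : Fin n → Mat d) : (prodState a).trace = ∏ u, (a u).trace := by
  simp only [Matrix.trace, Matrix.diag_apply, prodState]
  exact sum_cfg_prod (fun u i => a u i i)

lemma prodState_conj (a : Fin n → Mat d) :
    (prodState a)ᴴ = prodState (fun u => (a u)ᴴ) := by
  ext x y
  simp [prodState, conjTranspose_apply]

lemma prodState_one : prodState (fun _ : Fin n => (1 : Mat d)) = 1 := by
  ext x y
  simp only [prodState, Matrix.one_apply]
  rw [Finset.prod_ite_zero]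
  simp [funext_iff]

lemma psd_sqrt {m : Type*} [Fintype m] [DecidableEq m] {A : Matrix m m ℂ} (hA : A.PosSemidef) :
    ∃ B : Matrix m m ℂ, A = Bᴴ * B := by
  have hH := hA.isHermitian
  refine ⟨diagonal (fun i => ((Real.sqrt (hH.eigenvalues i) : ℝ) : ℂ)) *
    (hH.eigenvectorUnitary : Matrix m m ℂ)ᴴ, ?_⟩
  conv_lhs => rw [spec A hH]
  rw [conjTranspose_mul, conjTranspose_conjTranspose, diagonal_conjTranspose, mul_assoc,
    mul_assoc]
  congr 1
  rw [← mul_assoc, diagonal_mul_diagonal]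
  congr 2
  ext i
  simp only [Pi.star_apply, RCLike.star_def, Complex.conj_ofReal, ← Complex.ofReal_mul,
    Real.mul_self_sqrt (hA.eigenvalues_nonneg i)]

lemma prodState_psd {a : Fin n → Mat d} (h : ∀ u, (a u).PosSemidef) :
    (prodState a).PosSemidef := by
  choose b hb using fun u => psd_sqrt (h u)
  have : prodState a = (prodState b)ᴴ * prodState b := by
    rw [prodState_conj, prodState_mul]
    congr 1
    ext1 u; exact hb u
  rw [this]
  exact posSemidef_conjTranspose_mul_self _

lemma Lf_nonneg {ρ : Matrix (Cfg n d) (Cfg n d) ℂ} (hρ : ρ.PosSemidef) {a : Fin n → Mat d}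
    (h : ∀ u, (a u).PosSemidef) : 0 ≤ Lf ρ a := by
  rw [Lf_apply]; exact trace_mul_nonneg (prodState_psd h) hρ

lemma Lf_star {ρ : Matrix (Cfg n d) (Cfg n d) ℂ} (hρ : ρ.IsHermitian) (a : Fin n → Mat d) :
    star (Lf ρ a) = Lf ρ (fun u => (a u)ᴴ) := by
  rw [Lf_apply, Lf_apply, ← trace_conjTranspose, conjTranspose_mul, hρ.eq, prodState_conj,
    Matrix.trace_mul_comm]

/-- rank-one projector on a column -/
def colProj (W : Mat d) (y : Fin d) : Mat d :=
  vecMulVec (fun i => W i y) (star (fun i => W i y))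

lemma colProj_apply (W : Mat d) (y i j : Fin d) : colProj W y i j = W i y * star (W j y) := rfl

lemma colProj_psd (W : Mat d) (y : Fin d) : (colProj W y).PosSemidef :=
  posSemidef_vecMulVec_self_star _

lemma colProj_sum_smul (W : Mat d) (t : Fin d → ℂ) :
    ∑ y, t y • colProj W y = W * diagonal t * Wᴴ := by
  ext i j
  rw [Matrix.mul_apply, Matrix.sum_apply]
  refine Finset.sum_congr rfl fun y _ => ?_
  rw [Matrix.smul_apply, colProj_apply, Matrix.mul_diagonal, conjTranspose_apply, smul_eq_mul]
  ring

lemma colProj_sum {W : Mat d} (hW : Wᴴ * W = 1) : ∑ y, colProj W y = 1 := by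
  have := colProj_sum_smul W (fun _ => 1)
  simp only [one_smul] at this
  rw [this, diagonal_one, mul_one, unit_comm hW]

lemma colProj_trace_mul (W A : Mat d) (y : Fin d) :
    (colProj W y * A).trace = (Wᴴ * A * W) y y := by
  unfold colProj
  simp only [Matrix.trace, Matrix.mul_apply, Matrix.diag_apply, vecMulVec_apply, conjTranspose_apply,
    Finset.sum_mul, Pi.star_apply]
  refine Finset.sum_congr rfl fun i _ => Finset.sum_congr rfl fun j _ => ?_
  ring

lemma colProj_trace {W : Mat d} (hW : Wᴴ * W = 1) (y : Fin d) : (colProj W y).trace = 1 := by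
  have := colProj_trace_mul W 1 y
  rw [mul_one, mul_one, hW] at this
  rw [this, one_apply_eq]

lemma colProj_density {W : Mat d} (hW : Wᴴ * W = 1) (y : Fin d) : IsDensity (colProj W y) :=
  ⟨colProj_psd W y, colProj_trace hW y⟩

lemma avg_one {R : Type*} [CommSemiring R] (F : Cfg n d → R) (v : Fin n) :
    (d : R) * ∑ k, F k = ∑ k, ∑ i, F (update k v i) := by
  have h1 : ∑ k : Cfg n d, ∑ _i : Fin d, F k = ∑ k, ∑ i, F (update k v i) := by
    rw [← Fintype.sum_prod_type' (f := fun (k : Cfg n d) (_ : Fin d) => F k),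
      ← Fintype.sum_prod_type' (f := fun (k : Cfg n d) (i : Fin d) => F (update k v i))]
    refine Finset.sum_nbij' (fun z => (update z.1 v z.2, z.1 v))
      (fun z => (update z.1 v z.2, z.1 v)) ?_ ?_ ?_ ?_ ?_ <;> simp
  rw [← h1]
  simp [Finset.mul_sum]

lemma avg_ml (hd : 0 < d) {V : Type*} [AddCommGroup V] [Module ℂ V]
    (μ : MultilinearMap ℂ (fun _ : Fin n => V) ℂ) (G : Cfg n d → ℂ)
    (a : Fin n → Cfg n d → Fin d → V) (T : Finset (Fin n))
    (hG : ∀ v ∈ T, ∀ k i, G (update k v i) = G k)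
    (ha : ∀ v ∈ T, ∀ u k i j, a u (update k v i) j = a u k j) :
    ∑ k, G k * μ (fun u => a u k (k u)) =
      ∑ k, G k * μ (fun u => if u ∈ T then (d : ℂ)⁻¹ • ∑ i, a u k i else a u k (k u)) := by
  induction T using Finset.induction_on with
  | empty => simp
  | insert v T hv ih =>
    rw [ih (fun w hw => hG w (Finset.mem_insert_of_mem hw))
      (fun w hw => ha w (Finset.mem_insert_of_mem hw))]
    have hd' : (d : ℂ) ≠ 0 := by exact_mod_cast hd.ne'
    apply mul_left_cancel₀ hd'
    rw [avg_one _ v, Finset.mul_sum]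
    refine Finset.sum_congr rfl fun k _ => ?_
    have hG' := hG v (Finset.mem_insert_self _ _)
    have ha' := ha v (Finset.mem_insert_self _ _)
    set b : Fin n → V := fun u => if u ∈ T then (d : ℂ)⁻¹ • ∑ i, a u k i else a u k (k u) with hb
    have e1 : ∀ i, (fun u => if u ∈ T then (d : ℂ)⁻¹ • ∑ j, a u (update k v i) j
        else a u (update k v i) ((update k v i) u)) = update b v (a v k i) := by
      intro i
      ext1 u
      by_cases hu : u = v
      · subst hu; simp [hv, ha']
      · simp [hu, ha', hb]
    have e2 : (fun u => if u ∈ insert v T then (d : ℂ)⁻¹ • ∑ i, a u k i else a u k (k u)) =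
        update b v ((d : ℂ)⁻¹ • ∑ i, a v k i) := by
      ext1 u
      by_cases hu : u = v
      · subst hu; simp
      · simp [hu, hb]
    simp only [hG', e1, e2]
    rw [← Finset.mul_sum, ← μ.map_update_sum, μ.map_update_smul, smul_eq_mul]
    field_simp

end Prod

section Meas

open Matrix Function

variable {n d : ℕ}

open Classical in
/-- eigenvector unitary, total version -/
def eU (A : Mat d) : Mat d :=
  if h : A.IsHermitian then (h.eigenvectorUnitary : Mat d) else 1

open Classical in
/-- eigenvalues, total version -/
def eV (A : Mat d) : Fin d → ℝ :=
  if h : A.IsHermitian then h.eigenvalues else 0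

lemma eU_unit (A : Mat d) : (eU A)ᴴ * eU A = 1 := by
  unfold eU
  split_ifs with h
  · exact unit_left A h
  · simp

lemma eU_spec {A : Mat d} (h : A.IsHermitian) :
    A = eU A * diagonal (fun i => (eV A i : ℂ)) * (eU A)ᴴ := by
  unfold eU eV
  rw [dif_pos h, dif_pos h]
  exact spec A h

lemma eU_sum {A : Mat d} (h : A.IsHermitian) :
    A = ∑ y, (eV A y : ℂ) • colProj (eU A) y := by
  rw [colProj_sum_smul]; exact eU_spec h

lemma conj_diag {W : Mat d} (hW : Wᴴ * W = 1) (D : Mat d) : Wᴴ * (W * D * Wᴴ) * W = D := by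
  calc Wᴴ * (W * D * Wᴴ) * W = (Wᴴ * W) * D * (Wᴴ * W) := by simp only [mul_assoc]
    _ = D := by rw [hW, one_mul, mul_one]

lemma eU_diag {A : Mat d} (h : A.IsHermitian) (y : Fin d) :
    (colProj (eU A) y * A).trace = (eV A y : ℂ) := by
  rw [colProj_trace_mul]
  have h1 := conj_diag (eU_unit A) (diagonal (fun i => (eV A i : ℂ)))
  rw [← eU_spec h] at h1
  rw [h1, diagonal_apply_eq]

lemma eV_nonneg {A : Mat d} (h : A.PosSemidef) (y : Fin d) : 0 ≤ eV A y := by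
  unfold eV
  rw [dif_pos h.isHermitian]; exact h.eigenvalues_nonneg y

lemma eV_sum {A : Mat d} (h : A.IsHermitian) : ((∑ y, eV A y : ℝ) : ℂ) = A.trace := by
  unfold eV
  rw [dif_pos h, h.trace_eq_sum_eigenvalues]
  simp

variable {B : Type*}

/-- local effect operators of the measurement `m` with outcomes `x`. -/
def Qx (U : B → Mat d) (m : Fin n → Option B) (x : Cfg n d) : Fin n → Mat d := fun u =>
  match m u with
  | some β => colProj (U β) (x u)
  | none => (d : ℂ)⁻¹ • 1

/-- outcome probability -/
def pQ (ρ : Matrix (Cfg n d) (Cfg n d) ℂ) (q : Fin n → Mat d) : ℝ := (Lf ρ q).re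

/-- unnormalised conditional marginals -/
def rQ (ρ : Matrix (Cfg n d) (Cfg n d) ℂ) (q : Fin n → Mat d) (u : Fin n) : Mat d :=
  fun i k => Lf ρ (update q u ((d : ℂ)⁻¹ • Matrix.single k i 1))

lemma Qx_some {U : B → Mat d} {m : Fin n → Option B} {u : Fin n} {β : B} (h : m u = some β)
    (x : Cfg n d) : Qx U m x u = colProj (U β) (x u) := by
  simp [Qx, h]

lemma Qx_none {U : B → Mat d} {m : Fin n → Option B} {u : Fin n} (h : m u = none)
    (x : Cfg n d) : Qx U m x u = (d : ℂ)⁻¹ • 1 := by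
  simp [Qx, h]

lemma Qx_psd (U : B → Mat d) (m : Fin n → Option B) (x : Cfg n d) (u : Fin n) :
    (Qx U m x u).PosSemidef := by
  cases h : m u with
  | some β => rw [Qx_some h]; exact colProj_psd _ _
  | none =>
    rw [Qx_none h]
    refine PosSemidef.smul PosSemidef.one ?_
    rw [← Complex.ofReal_natCast, ← Complex.ofReal_inv]
    exact Complex.zero_le_real.mpr (by positivity)

lemma Qx_update {U : B → Mat d} {m : Fin n → Option B} {v : Fin n} (h : m v = none)
    (x : Cfg n d) (i : Fin d) : Qx U m (update x v i) = Qx U m x := by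
  ext1 u
  by_cases hu : u = v
  · subst hu; rw [Qx_none h, Qx_none h]
  · simp [Qx, hu]

section
variable {ρ : Matrix (Cfg n d) (Cfg n d) ℂ}
lemma pQ_eq (hρ : IsDensity ρ) {q : Fin n → Mat d} (hq : ∀ u, (q u).PosSemidef) : (pQ ρ q : ℂ) = Lf ρ q := by
  have := Lf_nonneg hρ.1 hq
  rw [pQ]
  refine Complex.ext rfl ?_
  rw [Complex.ofReal_im]
  exact (Complex.nonneg_iff.mp this).2

lemma pQ_nonneg (hρ : IsDensity ρ) {q : Fin n → Mat d} (hq : ∀ u, (q u).PosSemidef) : 0 ≤ pQ ρ q :=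
  (Complex.nonneg_iff.mp (Lf_nonneg hρ.1 hq)).1

lemma rQ_trace_mul (q : Fin n → Mat d) (u : Fin n) (X : Mat d) :
    (X * rQ ρ q u).trace = Lf ρ (update q u ((d : ℂ)⁻¹ • X)) := by
  conv_rhs => rw [Matrix.matrix_eq_sum_single X]
  simp only [Finset.smul_sum]
  rw [MultilinearMap.map_update_sum]
  simp only [MultilinearMap.map_update_sum, MultilinearMap.map_update_smul, Matrix.trace, Matrix.mul_apply,
    Matrix.diag_apply, rQ]
  refine Finset.sum_congr rfl fun i _ => Finset.sum_congr rfl fun k _ => ?_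
  have : Matrix.single i k (X i k) = X i k • Matrix.single i k (1 : ℂ) := by
    rw [Matrix.smul_single, smul_eq_mul, mul_one]
  rw [this, MultilinearMap.map_update_smul]
  simp only [smul_eq_mul]; ring

lemma rQ_psd (hρ : IsDensity ρ) {q : Fin n → Mat d} (hq : ∀ u, (q u).PosSemidef) (u : Fin n) :
    (rQ ρ q u).PosSemidef := by
  refine PosSemidef.of_dotProduct_mulVec_nonneg ?_ ?_
  · ext i k
    rw [conjTranspose_apply, rQ, rQ, Lf_star hρ.1.isHermitian]
    congr 1
    ext1 w
    by_cases hw : w = u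
    · subst hw
      simp only [update_self, conjTranspose_smul, conjTranspose_single]
      simp
    · simp only [update_of_ne hw]
      exact (hq w).isHermitian
  · intro a
    have h1 : star a ⬝ᵥ (rQ ρ q u) *ᵥ a = (vecMulVec a (star a) * rQ ρ q u).trace := by
      rw [Matrix.trace_mul_comm, Matrix.mul_vecMulVec, Matrix.trace_vecMulVec, dotProduct_comm]
    rw [h1, rQ_trace_mul]
    refine Lf_nonneg hρ.1 fun w => ?_
    by_cases hw : w = u
    · subst hw
      rw [update_self]
      refine PosSemidef.smul (posSemidef_vecMulVec_self_star a) ?_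
      rw [← Complex.ofReal_natCast, ← Complex.ofReal_inv]
      exact Complex.zero_le_real.mpr (by positivity)
    · rw [update_of_ne hw]; exact hq w

lemma rQ_trace {q : Fin n → Mat d} {u : Fin n} (hu : q u = (d : ℂ)⁻¹ • 1) :
    (rQ ρ q u).trace = Lf ρ q := by
  have := rQ_trace_mul (ρ := ρ) q u 1
  rw [one_mul] at this
  rw [this, ← hu, update_eq_self]

end

end Meas

section Sigma

open Matrix Function

variable {n d : ℕ} {B : Type*}
variable (ρ : Matrix (Cfg n d) (Cfg n d) ℂ) (U : B → Mat d) (m : Fin n → Option B)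

/-- local eigenbases -/
def Wm (u : Fin n) (k : Cfg n d) : Mat d :=
  match m u with
  | some β => U β
  | none => eU (rQ ρ (Qx U m k) u)

/-- local conditional eigenvalues -/
def cm (u : Fin n) (k : Cfg n d) (i : Fin d) : ℝ :=
  match m u with
  | some _ => 1
  | none => d * eV (rQ ρ (Qx U m k) u) i / pQ ρ (Qx U m k)

/-- eigenvalues of the rounded state -/
def sm (k : Cfg n d) : ℝ := pQ ρ (Qx U m k) * ∏ u, cm ρ U m u k (k u)

/-- eigenvectors of the rounded state -/
def Vm : Matrix (Cfg n d) (Cfg n d) ℂ := fun y k => ∏ u, Wm ρ U m u k (y u) (k u)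

/-- the rounded state -/
def sigm : Matrix (Cfg n d) (Cfg n d) ℂ :=
  Vm ρ U m * diagonal (fun k => (sm ρ U m k : ℂ)) * (Vm ρ U m)ᴴ

variable {ρ U m}

lemma Wm_some {u : Fin n} {β : B} (h : m u = some β) (k : Cfg n d) : Wm ρ U m u k = U β := by
  simp [Wm, h]

lemma Wm_none {u : Fin n} (h : m u = none) (k : Cfg n d) :
    Wm ρ U m u k = eU (rQ ρ (Qx U m k) u) := by
  simp [Wm, h]

lemma cm_some {u : Fin n} {β : B} (h : m u = some β) (k : Cfg n d) (i : Fin d) :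
    cm ρ U m u k i = 1 := by
  simp [cm, h]

lemma cm_none {u : Fin n} (h : m u = none) (k : Cfg n d) (i : Fin d) :
    cm ρ U m u k i = d * eV (rQ ρ (Qx U m k) u) i / pQ ρ (Qx U m k) := by
  simp [cm, h]

lemma Wm_unit (hU : ∀ β, (U β)ᴴ * U β = 1) (u : Fin n) (k : Cfg n d) :
    (Wm ρ U m u k)ᴴ * Wm ρ U m u k = 1 := by
  cases h : m u with
  | some β => rw [Wm_some h]; exact hU β
  | none => rw [Wm_none h]; exact eU_unit _

lemma Wm_congr {k k' : Cfg n d} (h : Qx U m k = Qx U m k') (u : Fin n) :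
    Wm ρ U m u k = Wm ρ U m u k' := by
  unfold Wm; rw [h]

lemma cm_congr {k k' : Cfg n d} (h : Qx U m k = Qx U m k') (u : Fin n) (i : Fin d) :
    cm ρ U m u k i = cm ρ U m u k' i := by
  unfold cm; rw [h]

lemma Qx_congr {k k' : Cfg n d} (h : ∀ u, m u ≠ none → k u = k' u) : Qx U m k = Qx U m k' := by
  ext1 u
  cases hu : m u with
  | some β => rw [Qx_some hu, Qx_some hu, h u (by simp [hu])]
  | none => rw [Qx_none hu, Qx_none hu]

lemma Vm_unit (hU : ∀ β, (U β)ᴴ * U β = 1) : (Vm ρ U m)ᴴ * Vm ρ U m = 1 := by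
  ext k k'
  have e : ((Vm ρ U m)ᴴ * Vm ρ U m) k k' =
      ∏ u, ((Wm ρ U m u k)ᴴ * Wm ρ U m u k') (k u) (k' u) := by
    simp only [Matrix.mul_apply, conjTranspose_apply, Vm, star_prod, ← Finset.prod_mul_distrib]
    exact sum_cfg_prod (fun u i => star (Wm ρ U m u k i (k u)) * Wm ρ U m u k' i (k' u))
  rw [e]
  by_cases hq : ∀ u, m u ≠ none → k u = k' u
  · have hQ := Qx_congr (U := U) hq
    have : ∀ u, ((Wm ρ U m u k)ᴴ * Wm ρ U m u k') (k u) (k' u) =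
        if k u = k' u then 1 else 0 := by
      intro u
      rw [← Wm_congr hQ u, Wm_unit hU, Matrix.one_apply]
    simp only [this, Matrix.one_apply]
    rw [Finset.prod_ite_zero]
    simp [funext_iff]
  · push Not at hq
    obtain ⟨u, hu, hne⟩ := hq
    have hkk : k ≠ k' := fun h => hne (by rw [h])
    rw [Matrix.one_apply_ne hkk]
    apply Finset.prod_eq_zero (Finset.mem_univ u)
    obtain ⟨β, hβ⟩ := Option.ne_none_iff_exists'.mp hu
    rw [Wm_some hβ, Wm_some hβ, hU, Matrix.one_apply_ne hne]

lemma sigm_eq : sigm ρ U m = ∑ k, (sm ρ U m k : ℂ) •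
    prodState (fun u => colProj (Wm ρ U m u k) (k u)) := by
  ext x y
  rw [sigm, Matrix.mul_apply, Matrix.sum_apply]
  refine Finset.sum_congr rfl fun k _ => ?_
  rw [Matrix.mul_diagonal, conjTranspose_apply, Matrix.smul_apply, smul_eq_mul]
  simp only [Vm, prodState, colProj_apply, Finset.prod_mul_distrib, star_prod]
  ring

lemma diag_eq (k : Cfg n d) : ((Vm ρ U m)ᴴ * ρ * Vm ρ U m) k k =
    Lf ρ (fun u => colProj (Wm ρ U m u k) (k u)) := by
  rw [Lf_apply]
  simp only [Matrix.trace, Matrix.mul_apply, Matrix.diag_apply, prodState, colProj_apply,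
    Vm, Finset.prod_mul_distrib, conjTranspose_apply, star_prod, Finset.sum_mul]
  refine Finset.sum_congr rfl fun x _ => Finset.sum_congr rfl fun y _ => ?_
  ring


lemma pm_eq (hρ : IsDensity ρ) (k : Cfg n d) :
    (pQ ρ (Qx U m k) : ℂ) = Lf ρ (Qx U m k) := pQ_eq hρ (Qx_psd U m k)

lemma pm_nonneg (hρ : IsDensity ρ) (k : Cfg n d) : 0 ≤ pQ ρ (Qx U m k) :=
  pQ_nonneg hρ (Qx_psd U m k)

lemma rm_psd (hρ : IsDensity ρ) (u : Fin n) (k : Cfg n d) : (rQ ρ (Qx U m k) u).PosSemidef :=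
  rQ_psd hρ (Qx_psd U m k) u

lemma rm_trace (hρ : IsDensity ρ) {u : Fin n} (hu : m u = none) (k : Cfg n d) :
    (rQ ρ (Qx U m k) u).trace = (pQ ρ (Qx U m k) : ℂ) := by
  rw [rQ_trace (Qx_none hu k), pm_eq hρ]

lemma ev_sum (hρ : IsDensity ρ) {u : Fin n} (hu : m u = none) (k : Cfg n d) :
    ∑ i, eV (rQ ρ (Qx U m k) u) i = pQ ρ (Qx U m k) := by
  have h := eV_sum (rm_psd (U := U) (m := m) hρ u k).isHermitian
  rw [rm_trace hρ hu] at h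
  exact_mod_cast h

lemma ev_zero (hρ : IsDensity ρ) {u : Fin n} (hu : m u = none) {k : Cfg n d}
    (hp : pQ ρ (Qx U m k) = 0) (i : Fin d) : eV (rQ ρ (Qx U m k) u) i = 0 := by
  have h := ev_sum (U := U) hρ hu k
  rw [hp, Finset.sum_eq_zero_iff_of_nonneg
    (fun i _ => eV_nonneg (rm_psd (U := U) (m := m) hρ u k) i)] at h
  exact h i (Finset.mem_univ _)

lemma cm_nonneg (hρ : IsDensity ρ) (u : Fin n) (k : Cfg n d) (i : Fin d) :
    0 ≤ cm ρ U m u k i := by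
  cases hu : m u with
  | some β => rw [cm_some hu]; exact zero_le_one
  | none =>
    rw [cm_none hu]
    exact div_nonneg (mul_nonneg (Nat.cast_nonneg _) (eV_nonneg (rm_psd hρ u k) i))
      (pm_nonneg hρ k)

lemma sm_nonneg (hρ : IsDensity ρ) (k : Cfg n d) : 0 ≤ sm ρ U m k :=
  mul_nonneg (pm_nonneg hρ k) (Finset.prod_nonneg fun u _ => cm_nonneg hρ u k _)

/-- total probability -/
lemma pm_sum (hd : 0 < d) (hU : ∀ β, (U β)ᴴ * U β = 1) (hρ : IsDensity ρ) :
    ∑ k, pQ ρ (Qx U m k) = 1 := by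
  have hd' : (d : ℂ) ≠ 0 := by exact_mod_cast hd.ne'
  have h1 : ((∑ k, pQ ρ (Qx U m k) : ℝ) : ℂ) = 1 := by
    rw [Complex.ofReal_sum]
    simp only [pm_eq hρ]
    have h := (Lf ρ).map_sum (fun (u : Fin n) (i : Fin d) => Qx U m (fun _ => i) u)
    have e : ∀ r : Cfg n d, (fun u => Qx U m (fun _ => r u) u) = Qx U m r := by
      intro r; ext1 u; rfl
    simp only [e] at h
    rw [← h]
    have e2 : (fun u => ∑ i : Fin d, Qx U m (fun _ => i) u) = fun _ => (1 : Mat d) := by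
      ext1 u
      cases hu : m u with
      | some β => simp only [Qx_some hu]; exact colProj_sum (hU β)
      | none =>
        simp only [Qx_none hu]
        rw [Finset.sum_const, Finset.card_univ, Fintype.card_fin, ← Nat.cast_smul_eq_nsmul ℂ,
          smul_smul, mul_inv_cancel₀ hd', one_smul]
    rw [e2, Lf_apply, prodState_one, one_mul, hρ.2]
  exact_mod_cast h1

/-- unmeasured sites -/
def unm (m : Fin n → Option B) : Finset (Fin n) := Finset.univ.filter (fun u => m u = none)

lemma mem_unm {u : Fin n} : u ∈ unm m ↔ m u = none := by simp [unm]

lemma unm_update {v : Fin n} (hv : v ∈ unm m) (k : Cfg n d) (i : Fin d) :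
    Qx U m (update k v i) = Qx U m k := Qx_update (mem_unm.mp hv) k i

/-- common value of both marginals -/
def mg (ρ : Matrix (Cfg n d) (Cfg n d) ℂ) (U : B → Mat d) (m : Fin n → Option B)
    (u : Fin n) (k : Cfg n d) : ℝ := pQ ρ (Qx U m k) * cm ρ U m u k (k u)

lemma marg_q (hd : 0 < d) (hU : ∀ β, (U β)ᴴ * U β = 1) (hρ : IsDensity ρ) (u : Fin n)
    (g : (Fin n → Mat d) → Fin d → ℝ) :
    ∑ k, (g (Qx U m k) (k u) : ℂ) * Lf ρ (fun v => colProj (Wm ρ U m v k) (k v)) =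
      ∑ k, (g (Qx U m k) (k u) : ℂ) * (mg ρ U m u k : ℂ) := by
  have hd' : (d : ℂ) ≠ 0 := by exact_mod_cast hd.ne'
  rw [avg_ml hd (Lf ρ) (fun k => (g (Qx U m k) (k u) : ℂ))
    (fun v k i => colProj (Wm ρ U m v k) i) ((unm m).erase u)]
  rotate_left
  · intro v hv k i
    rw [unm_update (Finset.mem_of_mem_erase hv), update_of_ne (Finset.ne_of_mem_erase hv).symm]
  · intro v hv w k i j
    rw [Wm_congr (unm_update (Finset.mem_of_mem_erase hv) k i)]
  refine Finset.sum_congr rfl fun k _ => ?_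
  congr 1
  have e : (fun v => if v ∈ (unm m).erase u then (d : ℂ)⁻¹ • ∑ i, colProj (Wm ρ U m v k) i
      else colProj (Wm ρ U m v k) (k v)) = update (Qx U m k) u (colProj (Wm ρ U m u k) (k u)) := by
    ext1 v
    by_cases hv : v = u
    · subst hv; simp
    · rw [update_of_ne hv]
      cases hm : m v with
      | some β =>
        rw [if_neg (by simp [mem_unm, hm]), Qx_some hm, Wm_some hm]
      | none =>
        rw [if_pos (by simp [mem_unm, hm, hv]), Qx_none hm, colProj_sum (Wm_unit hU v k)]
  rw [e, mg]
  cases hm : m u with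
  | some β =>
    rw [cm_some hm, mul_one, pm_eq hρ, Wm_some hm, ← Qx_some hm k, update_eq_self]
  | none =>
    have h1 := rQ_trace_mul (ρ := ρ) (Qx U m k) u ((d : ℂ) • colProj (Wm ρ U m u k) (k u))
    rw [smul_smul, inv_mul_cancel₀ hd', one_smul] at h1
    rw [← h1, smul_mul_assoc, Matrix.trace_smul, Wm_none hm,
      eU_diag (rm_psd hρ u k).isHermitian, cm_none hm]
    by_cases hp : pQ ρ (Qx U m k) = 0
    · rw [ev_zero hρ hm hp]; simp
    · rw [mul_div_cancel₀ _ hp]; push_cast; rfl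

lemma marg_s (hd : 0 < d) (hρ : IsDensity ρ) (u : Fin n)
    (g : (Fin n → Mat d) → Fin d → ℝ) :
    ∑ k, (g (Qx U m k) (k u) : ℂ) * (sm ρ U m k : ℂ) =
      ∑ k, (g (Qx U m k) (k u) : ℂ) * (mg ρ U m u k : ℂ) := by
  have hd' : (d : ℂ) ≠ 0 := by exact_mod_cast hd.ne'
  have h := avg_ml hd (MultilinearMap.mkPiAlgebra ℂ (Fin n) ℂ)
    (fun k => (g (Qx U m k) (k u) : ℂ) * (pQ ρ (Qx U m k) : ℂ))
    (fun v k i => (cm ρ U m v k i : ℂ)) ((unm m).erase u) ?_ ?_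
  rotate_left
  · intro v hv k i
    rw [unm_update (Finset.mem_of_mem_erase hv), update_of_ne (Finset.ne_of_mem_erase hv).symm]
  · intro v hv w k i j
    rw [cm_congr (unm_update (Finset.mem_of_mem_erase hv) k i)]
  simp only [MultilinearMap.mkPiAlgebra_apply] at h
  have e1 : ∀ k, (g (Qx U m k) (k u) : ℂ) * (sm ρ U m k : ℂ) =
      (g (Qx U m k) (k u) : ℂ) * (pQ ρ (Qx U m k) : ℂ) * ∏ v, (cm ρ U m v k (k v) : ℂ) := by
    intro k; rw [sm]; push_cast; ring
  simp only [e1]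
  rw [h]
  refine Finset.sum_congr rfl fun k _ => ?_
  rw [mul_assoc]
  congr 1
  rw [mg, Complex.ofReal_mul]
  by_cases hp : pQ ρ (Qx U m k) = 0
  · rw [hp]; simp
  congr 1
  rw [Finset.prod_eq_single u]
  · simp
  · intro v _ hv
    cases hm : m v with
    | some β => rw [if_neg (by simp [mem_unm, hm]), cm_some hm, Complex.ofReal_one]
    | none =>
      rw [if_pos (by simp [mem_unm, hm, hv])]
      simp only [cm_none hm]
      rw [← Complex.ofReal_sum, ← Finset.sum_div, ← Finset.mul_sum, ev_sum hρ hm,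
        mul_div_cancel_right₀ _ hp, smul_eq_mul, Complex.ofReal_natCast, inv_mul_cancel₀ hd']
  · simp

lemma marg (hd : 0 < d) (hU : ∀ β, (U β)ᴴ * U β = 1) (hρ : IsDensity ρ) (u : Fin n)
    (g : (Fin n → Mat d) → Fin d → ℝ) :
    ∑ k, ((((Vm ρ U m)ᴴ * ρ * Vm ρ U m) k k).re) * g (Qx U m k) (k u) =
      ∑ k, sm ρ U m k * g (Qx U m k) (k u) := by
  have h := (marg_q hd hU hρ u g).trans (marg_s (U := U) (m := m) hd hρ u g).symm
  have h2 := congrArg Complex.re h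
  simp only [Complex.re_sum, ← diag_eq, Complex.re_ofReal_mul, Complex.ofReal_re] at h2
  simpa only [mul_comm] using h2

lemma sm_sum (hd : 0 < d) (hU : ∀ β, (U β)ᴴ * U β = 1) (hρ : IsDensity ρ) (u : Fin n) :
    ∑ k, sm ρ U m k = 1 := by
  have h := marg (m := m) hd hU hρ u (fun _ _ => 1)
  simp only [mul_one] at h
  rw [← h]
  have h2 : ((Vm ρ U m)ᴴ * ρ * Vm ρ U m).trace = 1 := by
    rw [Matrix.trace_mul_comm, ← mul_assoc, unit_comm (Vm_unit hU), one_mul, hρ.2]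
  have := congrArg Complex.re h2
  rw [Matrix.trace, Complex.re_sum] at this
  simpa using this

lemma sigm_density (hd : 0 < d) (hU : ∀ β, (U β)ᴴ * U β = 1) (hρ : IsDensity ρ) (u : Fin n) :
    IsDensity (sigm ρ U m) :=
  density_diag (Vm_unit hU) _ (sm_nonneg hρ) (sm_sum hd hU hρ u)

lemma sigm_sep (hd : 0 < d) (hU : ∀ β, (U β)ᴴ * U β = 1) (hρ : IsDensity ρ) (u : Fin n) :
    IsSeparable (sigm ρ U m) := by
  let e := Fintype.equivFin (Cfg n d)
  refine ⟨Fintype.card (Cfg n d), fun i => sm ρ U m (e.symm i),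
    fun i u => colProj (Wm ρ U m u (e.symm i)) (e.symm i u), fun i => sm_nonneg hρ _, ?_,
    fun i u => colProj_density (Wm_unit hU _ _) _, ?_⟩
  · rw [Equiv.sum_comp e.symm (fun k => sm ρ U m k)]; exact sm_sum hd hU hρ u
  · rw [sigm_eq]
    exact (Equiv.sum_comp e.symm (fun k => (sm ρ U m k : ℂ) •
      prodState (fun u => colProj (Wm ρ U m u k) (k u)))).symm

lemma q_nonneg (hρ : IsDensity ρ) (k : Cfg n d) :
    0 ≤ (((Vm ρ U m)ᴴ * ρ * Vm ρ U m) k k).re := by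
  have := (hρ.1.conjTranspose_mul_mul_same (Vm ρ U m)).diag_nonneg (i := k)
  exact (Complex.nonneg_iff.mp this).1

open Classical in
lemma q_zero_of (hd : 0 < d) (hU : ∀ β, (U β)ᴴ * U β = 1) (hρ : IsDensity ρ) (u : Fin n)
    (g : (Fin n → Mat d) → Fin d → Prop) (hg : ∀ k, g (Qx U m k) (k u) → sm ρ U m k = 0)
    (k : Cfg n d) (hk : g (Qx U m k) (k u)) : (((Vm ρ U m)ᴴ * ρ * Vm ρ U m) k k).re = 0 := by
  have h := marg (m := m) hd hU hρ u (fun q i => if g q i then 1 else 0)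
  have h0 : ∑ k, sm ρ U m k * (if g (Qx U m k) (k u) then (1 : ℝ) else 0) = 0 := by
    refine Finset.sum_eq_zero fun k _ => ?_
    split_ifs with h1
    · rw [hg k h1, zero_mul]
    · rw [mul_zero]
  rw [h0, Finset.sum_eq_zero_iff_of_nonneg] at h
  · have := h k (Finset.mem_univ _)
    rwa [if_pos hk, mul_one] at this
  · intro k _
    refine mul_nonneg (q_nonneg hρ k) ?_
    split_ifs <;> norm_num

/-- value of `cm` in terms of the effect family -/
def cq (ρ : Matrix (Cfg n d) (Cfg n d) ℂ) (m : Fin n → Option B)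
    (u : Fin n) (q : Fin n → Mat d) (i : Fin d) : ℝ :=
  match m u with
  | some _ => 1
  | none => d * eV (rQ ρ q u) i / pQ ρ q

lemma cm_eq_cq (u : Fin n) (k : Cfg n d) (i : Fin d) :
    cm ρ U m u k i = cq ρ m u (Qx U m k) i := rfl

lemma entropy_ge (hd : 0 < d) (hU : ∀ β, (U β)ᴴ * U β = 1) (hρ : IsDensity ρ) (u₀ : Fin n) :
    entropy ρ ≤ entropy (sigm ρ U m) := by
  have h0 : ∀ k, sm ρ U m k = 0 → (((Vm ρ U m)ᴴ * ρ * Vm ρ U m) k k).re = 0 := by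
    intro k hk
    rw [sm, mul_eq_zero, Finset.prod_eq_zero_iff] at hk
    rcases hk with hk | ⟨u, _, hk⟩
    · refine q_zero_of hd hU hρ u₀ (fun q _ => pQ ρ q = 0) ?_ k hk
      intro k hk; rw [sm, hk, zero_mul]
    · refine q_zero_of hd hU hρ u (fun q i => cq ρ m u q i = 0) ?_ k hk
      intro k hk
      rw [sm, Finset.prod_eq_zero (Finset.mem_univ u) (by rw [cm_eq_cq, hk]), mul_zero]
  refine (klein hρ (Vm_unit hU) (sm ρ U m) (sm_nonneg hρ) (sm_sum hd hU hρ u₀) h0).trans ?_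
  rw [sigm, entropy_diag (Vm_unit hU), neg_le_neg_iff]
  apply le_of_eq
  have hlog : ∀ k, sm ρ U m k ≠ 0 → Real.log (sm ρ U m k) =
      Real.log (pQ ρ (Qx U m k)) + ∑ u, Real.log (cq ρ m u (Qx U m k) (k u)) := by
    intro k hk
    have hk' := hk
    rw [sm] at hk
    have h1 := left_ne_zero_of_mul hk
    have h2 := right_ne_zero_of_mul hk
    rw [sm, Real.log_mul h1 h2, Real.log_prod]
    · rfl
    · intro u hu; exact (Finset.prod_ne_zero_iff.mp h2) u hu
  have eA : ∀ (w : Cfg n d → ℝ), (∀ k, sm ρ U m k = 0 → w k = 0) →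
      ∑ k, w k * Real.log (sm ρ U m k) = ∑ k, w k * Real.log (pQ ρ (Qx U m k)) +
        ∑ u, ∑ k, w k * Real.log (cq ρ m u (Qx U m k) (k u)) := by
    intro w hw
    rw [Finset.sum_comm, ← Finset.sum_add_distrib]
    refine Finset.sum_congr rfl fun k _ => ?_
    by_cases hk : sm ρ U m k = 0
    · simp [hw k hk]
    · rw [hlog k hk, mul_add, Finset.mul_sum]
  rw [eA _ (fun k h => h), eA _ h0]
  congr 1
  · exact (marg hd hU hρ u₀ (fun q _ => Real.log (pQ ρ q))).symm
  · refine Finset.sum_congr rfl fun u _ => ?_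
    exact (marg hd hU hρ u (fun q i => Real.log (cq ρ m u q i))).symm

/-- expectation of a two-site product operator in the rounded state -/
lemma sigm_two (hd : 0 < d) (hU : ∀ β, (U β)ᴴ * U β = 1) (hρ : IsDensity ρ) {u v : Fin n}
    (huv : u ≠ v) (hu : m u = none) (hv : m v = none) (X Y : Mat d) :
    (prodState (update (update (fun _ => (1 : Mat d)) v Y) u X) * sigm ρ U m).trace =
      ∑ k, (X * rQ ρ (Qx U m k) u).trace * (Y * rQ ρ (Qx U m k) v).trace /
        (pQ ρ (Qx U m k) : ℂ) := by
  have hd' : (d : ℂ) ≠ 0 := by exact_mod_cast hd.ne'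
  set Z : Fin n → Mat d := update (update (fun _ => (1 : Mat d)) v Y) u X with hZ
  have h := avg_ml hd (MultilinearMap.mkPiAlgebra ℂ (Fin n) ℂ)
    (fun k => (pQ ρ (Qx U m k) : ℂ))
    (fun w k i => (cm ρ U m w k i : ℂ) * (Z w * colProj (Wm ρ U m w k) i).trace) (unm m) ?_ ?_
  rotate_left
  · intro v hv k i
    rw [unm_update hv]
  · intro v hv w k i j
    rw [cm_congr (unm_update hv k i), Wm_congr (unm_update hv k i)]
  simp only [MultilinearMap.mkPiAlgebra_apply] at h
  have e1 : (prodState Z * sigm ρ U m).trace = ∑ k, (pQ ρ (Qx U m k) : ℂ) *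
      ∏ w, ((cm ρ U m w k (k w) : ℂ) * (Z w * colProj (Wm ρ U m w k) (k w)).trace) := by
    rw [sigm_eq, Finset.mul_sum, Matrix.trace_sum]
    refine Finset.sum_congr rfl fun k _ => ?_
    rw [Matrix.mul_smul, Matrix.trace_smul, prodState_mul, prodState_trace, sm, smul_eq_mul,
      Finset.prod_mul_distrib]
    push_cast; ring
  rw [e1, h]
  refine Finset.sum_congr rfl fun k _ => ?_
  by_cases hp : pQ ρ (Qx U m k) = 0
  · rw [hp]; simp
  have hp' : (pQ ρ (Qx U m k) : ℂ) ≠ 0 := by exact_mod_cast hp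
  have e2 : ∀ w, m w = none → (d : ℂ)⁻¹ • ∑ i, (cm ρ U m w k i : ℂ) *
      (Z w * colProj (Wm ρ U m w k) i).trace =
      (Z w * rQ ρ (Qx U m k) w).trace / (pQ ρ (Qx U m k) : ℂ) := by
    intro w hw
    conv_rhs => rw [eU_sum (rm_psd (U := U) (m := m) hρ w k).isHermitian]
    rw [Finset.mul_sum, Matrix.trace_sum, Finset.sum_div, Finset.smul_sum]
    refine Finset.sum_congr rfl fun i _ => ?_
    rw [cm_none hw, Wm_none hw, Matrix.mul_smul, Matrix.trace_smul, smul_eq_mul, smul_eq_mul]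
    push_cast
    field_simp
  rw [Finset.prod_eq_mul u v huv]
  · rw [if_pos (mem_unm.mpr hu), if_pos (mem_unm.mpr hv), e2 u hu, e2 v hv]
    have z1 : Z u = X := by simp [hZ]
    have z2 : Z v = Y := by simp [hZ, huv.symm]
    rw [z1, z2]
    field_simp
  · rintro w _ ⟨hwu, hwv⟩
    have z : Z w = 1 := by simp [hZ, hwu, hwv]
    cases hm : m w with
    | some β =>
      rw [if_neg (by simp [mem_unm, hm]), cm_some hm, z, one_mul, colProj_trace (Wm_unit hU w k)]
      simp
    | none =>
      rw [if_pos (mem_unm.mpr hm), e2 w hm, z, one_mul, rm_trace hρ hm, div_self hp']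
  · simp
  · simp

end Sigma

section Incr

open Matrix Function

variable {n d : ℕ} {B : Type*}

lemma avg_pair (hd : 0 < d) {R : Type*} [Field R] [CharZero R] (F F' g : Cfg n d → R) (v : Fin n)
    (hF : ∀ x, ∑ i, F' (update x v i) = d * F x) (hg : ∀ x i, g (update x v i) = g x) :
    ∑ x, F' x * g x = ∑ x, F x * g x := by
  have hd' : (d : R) ≠ 0 := by exact_mod_cast hd.ne'
  apply mul_left_cancel₀ hd'
  rw [avg_one _ v, Finset.mul_sum]
  refine Finset.sum_congr rfl fun x _ => ?_
  simp only [hg]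
  rw [← Finset.sum_mul, hF]; ring

lemma incr_abs (hd : 0 < d) (R R' : Cfg n d → ℂ) (P P' : Cfg n d → ℝ) (v : Fin n) (K : ℝ)
    (hP' : ∀ x, 0 ≤ P' x)
    (hR' : ∀ x, ‖R' x‖ ≤ K * P' x)
    (iR : ∀ x i, R (update x v i) = R x) (iP : ∀ x i, P (update x v i) = P x)
    (sR : ∀ x, ∑ i, R' (update x v i) = d * R x) (sP : ∀ x, ∑ i, P' (update x v i) = d * P x)
    (hone : ∑ x, P' x = 1) :
    (∑ x, ‖R' x - R x * (P' x : ℂ) / (P x : ℂ)‖) ^ 2 ≤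
      ∑ x, ‖R' x‖ ^ 2 / P' x - ∑ x, ‖R x‖ ^ 2 / P x := by
  have hz : ∀ x, P' x = 0 → R' x = 0 := by
    intro x hx
    have := hR' x
    rw [hx, mul_zero] at this
    exact norm_le_zero_iff.mp this
  set D : Cfg n d → ℂ := fun x => R' x - R x * (P' x : ℂ) / (P x : ℂ) with hD
  have cs : (∑ x, ‖D x‖) ^ 2 ≤ (∑ x, ‖D x‖ ^ 2 / P' x) * ∑ x, P' x := by
    refine Finset.sum_sq_le_sum_mul_sum_of_sq_le_mul _ (fun x _ => ?_) (fun x _ => hP' x)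
      (fun x _ => ?_)
    · exact div_nonneg (sq_nonneg _) (hP' x)
    · by_cases h : P' x = 0
      · simp [hD, h, hz x h]
      · exact le_of_eq (by field_simp)
  rw [hone, mul_one] at cs
  refine cs.trans (le_of_eq ?_)
  have e1 : ∀ x, ‖D x‖ ^ 2 / P' x = ‖R' x‖ ^ 2 / P' x -
      2 * (R' x * (star (R x) / (P x : ℂ))).re + P' x * (‖R x‖ ^ 2 / P x ^ 2) := by
    intro x
    by_cases h : P' x = 0
    · simp [hD, h, hz x h]
    · have h2 : ‖D x‖ ^ 2 = ‖R' x‖ ^ 2 -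
          2 * P' x * (R' x * (star (R x) / (P x : ℂ))).re + P' x ^ 2 * (‖R x‖ ^ 2 / P x ^ 2) := by
        have e3 : R x * (P' x : ℂ) / (P x : ℂ) = ((P' x / P x : ℝ) : ℂ) * R x := by
          push_cast; ring
        have e4 : R' x * (star (R x) / (P x : ℂ)) = (((P x)⁻¹ : ℝ) : ℂ) * (R' x * star (R x)) := by
          push_cast; ring
        rw [hD]
        simp only
        rw [e3, e4, Complex.re_ofReal_mul]
        simp only [← Complex.normSq_eq_norm_sq, Complex.normSq_apply, Complex.sub_re,
          Complex.sub_im, Complex.mul_im, Complex.mul_re, Complex.ofReal_re, Complex.ofReal_im,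
          RCLike.star_def, Complex.conj_re, Complex.conj_im]
        ring
      rw [h2]
      field_simp
  simp only [e1]
  rw [Finset.sum_add_distrib, Finset.sum_sub_distrib, ← Finset.mul_sum, ← Complex.re_sum,
    avg_pair hd R R' _ v sR (fun x i => by rw [iR, iP]),
    avg_pair hd P P' _ v sP (fun x i => by rw [iR, iP])]
  have e5 : (∑ x, R x * (star (R x) / (P x : ℂ))).re = ∑ x, ‖R x‖ ^ 2 / P x := by
    rw [Complex.re_sum]
    refine Finset.sum_congr rfl fun x _ => ?_
    rw [← mul_div_assoc, RCLike.star_def, Complex.mul_conj, Complex.normSq_eq_norm_sq,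
      ← Complex.ofReal_div, Complex.ofReal_re]
  have e6 : ∑ x, P x * (‖R x‖ ^ 2 / P x ^ 2) = ∑ x, ‖R x‖ ^ 2 / P x := by
    refine Finset.sum_congr rfl fun x _ => ?_
    by_cases h : P x = 0
    · simp [h]
    · field_simp
  rw [e5, e6]; ring

variable {ρ : Matrix (Cfg n d) (Cfg n d) ℂ} {U : B → Mat d} {m : Fin n → Option B}

/-- `R_u^x(X)` -/
def RR (ρ : Matrix (Cfg n d) (Cfg n d) ℂ) (U : B → Mat d) (m : Fin n → Option B) (u : Fin n)
    (X : Mat d) (x : Cfg n d) : ℂ := (X * rQ ρ (Qx U m x) u).trace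

lemma RR_eq (u : Fin n) (X : Mat d) (x : Cfg n d) :
    RR ρ U m u X x = Lf ρ (update (Qx U m x) u ((d : ℂ)⁻¹ • X)) := rQ_trace_mul _ _ _

lemma RR_le (hρ : IsDensity ρ) {u : Fin n} (hu : m u = none) (X : Mat d) (x : Cfg n d) :
    ‖RR ρ U m u X x‖ ≤ opNorm X * pQ ρ (Qx U m x) := by
  have hr := rm_psd (U := U) (m := m) hρ u x
  have ht := rm_trace (U := U) hρ hu x
  have hp0 := pm_nonneg (U := U) (m := m) hρ x
  unfold RR
  by_cases hp : pQ ρ (Qx U m x) = 0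
  · rw [hp, Complex.ofReal_zero, hr.trace_eq_zero_iff] at ht
    rw [ht, hp]; simp
  · have hp' : (pQ ρ (Qx U m x) : ℂ) ≠ 0 := by exact_mod_cast hp
    have hD : IsDensity ((((pQ ρ (Qx U m x))⁻¹ : ℝ) : ℂ) • rQ ρ (Qx U m x) u) := by
      constructor
      · exact hr.smul (Complex.zero_le_real.mpr (inv_nonneg.mpr hp0))
      · rw [Matrix.trace_smul, ht, smul_eq_mul, Complex.ofReal_inv, inv_mul_cancel₀ hp']
    have h := trace_le X _ hD
    rw [Matrix.mul_smul, Matrix.trace_smul, norm_smul, Complex.norm_real,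
      Real.norm_of_nonneg (inv_nonneg.mpr hp0)] at h
    have hpos : 0 < pQ ρ (Qx U m x) := lt_of_le_of_ne hp0 (Ne.symm hp)
    rwa [inv_mul_le_iff₀ hpos, mul_comm] at h

lemma Qx_step (v : Fin n) (β : B) (x : Cfg n d) :
    Qx U (update m v (some β)) x = update (Qx U m x) v (colProj (U β) (x v)) := by
  ext1 w
  by_cases hw : w = v
  · subst hw; simp [Qx]
  · simp [Qx, hw]

lemma Qx_step_update {v : Fin n} (hv : m v = none) (β : B) (x : Cfg n d) (i : Fin d) :
    Qx U (update m v (some β)) (update x v i) = update (Qx U m x) v (colProj (U β) i) := by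
  rw [Qx_step, Qx_update hv, update_self]

lemma sum_P (hd : 0 < d) (hU : ∀ β, (U β)ᴴ * U β = 1) (hρ : IsDensity ρ)
    {v : Fin n} (hv : m v = none) (β : B) (x : Cfg n d) :
    ∑ i, pQ ρ (Qx U (update m v (some β)) (update x v i)) = d * pQ ρ (Qx U m x) := by
  have hd' : (d : ℂ) ≠ 0 := by exact_mod_cast hd.ne'
  have h : ((∑ i, pQ ρ (Qx U (update m v (some β)) (update x v i)) : ℝ) : ℂ) =
      ((d * pQ ρ (Qx U m x) : ℝ) : ℂ) := by
    push_cast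
    simp only [pm_eq hρ]
    simp only [Qx_step_update hv]
    rw [← MultilinearMap.map_update_sum, colProj_sum (hU β)]
    have : (1 : Mat d) = (d : ℂ) • (Qx U m x v) := by
      rw [Qx_none hv, smul_smul, mul_inv_cancel₀ hd', one_smul]
    rw [this, MultilinearMap.map_update_smul, update_eq_self, smul_eq_mul]
  exact_mod_cast h

lemma sum_R (hd : 0 < d) (hU : ∀ β, (U β)ᴴ * U β = 1)
    {u v : Fin n} (huv : u ≠ v) (hv : m v = none) (β : B) (X : Mat d) (x : Cfg n d) :
    ∑ i, RR ρ U (update m v (some β)) u X (update x v i) = d * RR ρ U m u X x := by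
  have hd' : (d : ℂ) ≠ 0 := by exact_mod_cast hd.ne'
  simp only [RR_eq, Qx_step_update hv]
  simp only [update_comm huv.symm]
  rw [← MultilinearMap.map_update_sum, colProj_sum (hU β)]
  have : (1 : Mat d) = (d : ℂ) • (update (Qx U m x) u ((d : ℂ)⁻¹ • X) v) := by
    rw [update_of_ne huv.symm, Qx_none hv, smul_smul, mul_inv_cancel₀ hd', one_smul]
  rw [this, MultilinearMap.map_update_smul, update_eq_self, smul_eq_mul]

/-- correlation measure -/
def DD (ρ : Matrix (Cfg n d) (Cfg n d) ℂ) (U : B → Mat d) (m : Fin n → Option B) (u v : Fin n)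
    (X : Mat d) (β : B) : ℝ :=
  ∑ x, ‖RR ρ U (update m v (some β)) u X x -
    RR ρ U m u X x * (pQ ρ (Qx U (update m v (some β)) x) : ℂ) / (pQ ρ (Qx U m x) : ℂ)‖

/-- potential -/
def Phi (ρ : Matrix (Cfg n d) (Cfg n d) ℂ) (U : B → Mat d) (u : Fin n) (X : Mat d)
    (m : Fin n → Option B) : ℝ :=
  if m u = none then ∑ x, ‖RR ρ U m u X x‖ ^ 2 / pQ ρ (Qx U m x) else opNorm X ^ 2

/-- measure a further site -/
def step (m : Fin n → Option B) (v : Fin n) (β : B) : Fin n → Option B :=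
  if m v = none then update m v (some β) else m

lemma Phi_nonneg (hρ : IsDensity ρ) (u : Fin n) (X : Mat d) : 0 ≤ Phi ρ U u X m := by
  unfold Phi
  split_ifs
  · exact Finset.sum_nonneg fun x _ => div_nonneg (sq_nonneg _) (pm_nonneg hρ x)
  · exact sq_nonneg _

lemma Phi_le (hd : 0 < d) (hU : ∀ β, (U β)ᴴ * U β = 1) (hρ : IsDensity ρ) (u : Fin n) (X : Mat d) :
    Phi ρ U u X m ≤ opNorm X ^ 2 := by
  unfold Phi
  split_ifs with hu
  · calc _ ≤ ∑ x, opNorm X ^ 2 * pQ ρ (Qx U m x) := by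
          refine Finset.sum_le_sum fun x _ => ?_
          have hp := pm_nonneg (U := U) (m := m) hρ x
          refine div_le_of_le_mul₀ hp (mul_nonneg (sq_nonneg _) hp) ?_
          have := pow_le_pow_left₀ (norm_nonneg _) (RR_le (U := U) hρ hu X x) 2
          refine this.trans (le_of_eq ?_)
          ring
      _ = opNorm X ^ 2 := by rw [← Finset.mul_sum, pm_sum hd hU hρ, mul_one]
  · exact le_refl _

lemma DD_le (hd : 0 < d) (hU : ∀ β, (U β)ᴴ * U β = 1) (hρ : IsDensity ρ)
    {u v : Fin n} (huv : u ≠ v) (hu : m u = none) (hv : m v = none) (X : Mat d) (β : B) :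
    DD ρ U m u v X β ^ 2 ≤ Phi ρ U u X (step m v β) - Phi ρ U u X m := by
  have hu' : update m v (some β) u = none := by rw [update_of_ne huv, hu]
  unfold Phi step
  rw [if_pos hv, if_pos hu, if_pos hu']
  refine incr_abs hd (RR ρ U m u X) (RR ρ U (update m v (some β)) u X) _ _ v (opNorm X)
    (pm_nonneg hρ) (RR_le hρ hu' X) ?_ ?_ (sum_R hd hU huv hv β X) (sum_P hd hU hρ hv β)
    (pm_sum hd hU hρ)
  · intro x i; simp only [RR, Qx_update hv]
  · intro x i; simp only [Qx_update hv]

lemma Phi_mono (hd : 0 < d) (hU : ∀ β, (U β)ᴴ * U β = 1) (hρ : IsDensity ρ)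
    (u v : Fin n) (X : Mat d) (β : B) :
    Phi ρ U u X m ≤ Phi ρ U u X (step m v β) := by
  by_cases hv : m v = none
  · by_cases huv : u = v
    · subst huv
      refine (Phi_le hd hU hρ u X).trans (le_of_eq ?_)
      unfold Phi step
      rw [if_pos hv, if_neg (by simp)]
    · by_cases hu : m u = none
      · have := DD_le hd hU hρ huv hu hv X β
        nlinarith [sq_nonneg (DD ρ U m u v X β)]
      · unfold Phi step
        rw [if_pos hv, if_neg hu, if_neg (by rwa [update_of_ne huv])]
  · unfold step; rw [if_neg hv]

lemma DD_nonneg (u v : Fin n) (X : Mat d) (β : B) : 0 ≤ DD ρ U m u v X β :=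
  Finset.sum_nonneg fun _ _ => norm_nonneg _

/-- energy difference for product operators -/
lemma diff_le (hd : 0 < d) (hU : ∀ β, (U β)ᴴ * U β = 1) (hρ : IsDensity ρ)
    {u v : Fin n} (huv : u ≠ v) (hu : m u = none) (hv : m v = none) (X Y : Mat d) (β : B)
    (t : Fin d → ℂ) (hY : Y = ∑ y, t y • colProj (U β) y) (Λ : ℝ) (ht : ∀ y, ‖t y‖ ≤ Λ) :
    ‖(prodState (update (update (fun _ => (1 : Mat d)) v Y) u X) * ρ).trace -
      (prodState (update (update (fun _ => (1 : Mat d)) v Y) u X) * sigm ρ U m).trace‖ ≤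
      Λ * DD ρ U m u v X β := by
  have hd' : (d : ℂ) ≠ 0 := by exact_mod_cast hd.ne'
  have hdr : (0 : ℝ) < d := by exact_mod_cast hd
  rw [sigm_two hd hU hρ huv hu hv]
  have e1 : (prodState (update (update (fun _ => (1 : Mat d)) v Y) u X) * ρ).trace =
      ∑ x, Lf ρ (update (update (Qx U m x) v ((d : ℂ)⁻¹ • Y)) u ((d : ℂ)⁻¹ • X)) := by
    rw [← Lf_apply]
    have h := (Lf ρ).map_sum (fun (w : Fin n) (i : Fin d) =>
      update (update (Qx U m (fun _ => i)) v ((d : ℂ)⁻¹ • Y)) u ((d : ℂ)⁻¹ • X) w)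
    have e : ∀ r : Cfg n d, (fun w => update (update (Qx U m (fun _ => r w)) v ((d : ℂ)⁻¹ • Y)) u
        ((d : ℂ)⁻¹ • X) w) = update (update (Qx U m r) v ((d : ℂ)⁻¹ • Y)) u ((d : ℂ)⁻¹ • X) := by
      intro r; ext1 w
      by_cases h1 : w = u
      · subst h1; simp
      · by_cases h2 : w = v
        · subst h2; simp [h1]
        · simp [h1, h2, Qx]
    simp only [e] at h
    rw [← h]
    congr 1
    have hc : ∀ A : Mat d, ∑ _i : Fin d, (d : ℂ)⁻¹ • A = A := by
      intro A
      rw [Finset.sum_const, Finset.card_univ, Fintype.card_fin, ← Nat.cast_smul_eq_nsmul ℂ,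
          smul_smul, mul_inv_cancel₀ hd', one_smul]
    ext1 w
    by_cases h1 : w = u
    · subst h1; simp only [update_self]; rw [hc]
    · simp only [update_of_ne h1]
      by_cases h2 : w = v
      · subst h2; simp only [update_self]; rw [hc]
      · simp only [update_of_ne h2]
        cases hw : m w with
        | some γ => simp only [Qx_some hw]; exact (colProj_sum (hU γ)).symm
        | none => simp only [Qx_none hw]; exact (hc 1).symm
  rw [e1, ← Finset.sum_sub_distrib]
  set D : Cfg n d → ℂ := fun x => RR ρ U (update m v (some β)) u X x -
    RR ρ U m u X x * (pQ ρ (Qx U (update m v (some β)) x) : ℂ) / (pQ ρ (Qx U m x) : ℂ) with hD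
  have e2 : ∀ x, Lf ρ (update (update (Qx U m x) v ((d : ℂ)⁻¹ • Y)) u ((d : ℂ)⁻¹ • X)) -
      (X * rQ ρ (Qx U m x) u).trace * (Y * rQ ρ (Qx U m x) v).trace / (pQ ρ (Qx U m x) : ℂ) =
      (d : ℂ)⁻¹ * ∑ y, t y * D (update x v y) := by
    intro x
    have a1 : Lf ρ (update (update (Qx U m x) v ((d : ℂ)⁻¹ • Y)) u ((d : ℂ)⁻¹ • X)) =
        (d : ℂ)⁻¹ * ∑ y, t y * RR ρ U (update m v (some β)) u X (update x v y) := by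
      rw [update_comm huv.symm, MultilinearMap.map_update_smul, hY,
        MultilinearMap.map_update_sum, smul_eq_mul]
      congr 1
      refine Finset.sum_congr rfl fun y _ => ?_
      rw [MultilinearMap.map_update_smul, RR_eq, Qx_step_update hv, smul_eq_mul,
        update_comm huv.symm]
    have a2 : (Y * rQ ρ (Qx U m x) v).trace = (d : ℂ)⁻¹ *
        ∑ y, t y * (pQ ρ (Qx U (update m v (some β)) (update x v y)) : ℂ) := by
      rw [rQ_trace_mul, MultilinearMap.map_update_smul, hY,
        MultilinearMap.map_update_sum, smul_eq_mul]
      congr 1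
      refine Finset.sum_congr rfl fun y _ => ?_
      rw [MultilinearMap.map_update_smul, pm_eq hρ, Qx_step_update hv, smul_eq_mul]
    rw [a1, a2, hD]
    simp only [Qx_update hv, RR, mul_sub, Finset.sum_sub_distrib]
    congr 1
    rw [Finset.mul_sum, Finset.mul_sum, Finset.mul_sum, Finset.sum_div]
    refine Finset.sum_congr rfl fun y _ => ?_
    ring
  simp only [e2]
  rw [← Finset.mul_sum, norm_mul, norm_inv, Complex.norm_natCast]
  have e3 : ‖∑ x, ∑ y, t y * D (update x v y)‖ ≤ ∑ x, ∑ y, Λ * ‖D (update x v y)‖ := by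
    refine (norm_sum_le _ _).trans (Finset.sum_le_sum fun x _ => ?_)
    refine (norm_sum_le _ _).trans (Finset.sum_le_sum fun y _ => ?_)
    rw [norm_mul]
    exact mul_le_mul_of_nonneg_right (ht y) (norm_nonneg _)
  have e4 : ∑ x, ∑ y, Λ * ‖D (update x v y)‖ = Λ * (d * DD ρ U m u v X β) := by
    simp only [← Finset.mul_sum]
    rw [← avg_one (fun x => ‖D x‖) v]
    rfl
  rw [e4] at e3
  rw [inv_mul_le_iff₀ hdr]
  refine e3.trans (le_of_eq ?_)
  ring

end Incr

section Basis

open Matrix Function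

/-- index set of measurement bases -/
abbrev BI (d : ℕ) : Type := Fin d × Fin d × Bool

/-- Hermitian operator basis -/
def bX (d : ℕ) (β : BI d) : Mat d :=
  if β.2.2 then Complex.I • Matrix.single β.1 β.2.1 (1 : ℂ) -
      Complex.I • Matrix.single β.2.1 β.1 (1 : ℂ)
  else Matrix.single β.1 β.2.1 (1 : ℂ) + Matrix.single β.2.1 β.1 (1 : ℂ)

lemma bX_herm (d : ℕ) (β : BI d) : (bX d β).IsHermitian := by
  unfold bX Matrix.IsHermitian
  split_ifs
  · simp only [conjTranspose_sub, conjTranspose_smul, conjTranspose_single, star_one,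
      RCLike.star_def, Complex.conj_I, neg_smul]
    abel
  · simp only [conjTranspose_add, conjTranspose_single, star_one]
    abel

/-- measurement bases -/
def bU (d : ℕ) (β : BI d) : Mat d := eU (bX d β)

lemma bU_unit (d : ℕ) (β : BI d) : (bU d β)ᴴ * bU d β = 1 := eU_unit _

/-- bound on the eigenvalues of the operator basis -/
def Lam (d : ℕ) : ℝ := ∑ β : BI d, ∑ y, |eV (bX d β) y|

lemma Lam_nonneg (d : ℕ) : 0 ≤ Lam d :=
  Finset.sum_nonneg fun _ _ => Finset.sum_nonneg fun _ _ => abs_nonneg _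

lemma eV_le (d : ℕ) (β : BI d) (y : Fin d) : ‖(eV (bX d β) y : ℂ)‖ ≤ Lam d := by
  rw [Complex.norm_real, Real.norm_eq_abs]
  refine (Finset.single_le_sum (f := fun y => |eV (bX d β) y|) (fun _ _ => abs_nonneg _)
    (Finset.mem_univ y)).trans ?_
  exact Finset.single_le_sum (f := fun β : BI d => ∑ y, |eV (bX d β) y|)
    (fun _ _ => Finset.sum_nonneg fun _ _ => abs_nonneg _) (Finset.mem_univ β)

lemma single_eq (d : ℕ) (j l : Fin d) : Matrix.single j l (1 : ℂ) =
    (1 / 2 : ℂ) • bX d (j, l, false) + (-(Complex.I / 2)) • bX d (j, l, true) := by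
  simp only [bX, if_true, Bool.false_eq_true, if_false, smul_add, smul_sub, smul_smul]
  have : -(Complex.I / 2) * Complex.I = 1 / 2 := by
    linear_combination (-1 / 2 : ℂ) * Complex.I_mul_I
  rw [this]
  have h2 : Matrix.single j l (1 : ℂ) = (1 / 2 : ℂ) • Matrix.single j l (1 : ℂ) +
      (1 / 2 : ℂ) • Matrix.single j l (1 : ℂ) := by
    rw [← add_smul]; norm_num
  conv_lhs => rw [h2]
  abel

variable {n d : ℕ} {ρ : Matrix (Cfg n d) (Cfg n d) ℂ} {m : Fin n → Option (BI d)}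

lemma diff_single (hd : 0 < d) (hρ : IsDensity ρ)
    {u v : Fin n} (huv : u ≠ v) (hu : m u = none) (hv : m v = none) (X : Mat d) (j l : Fin d) :
    ‖(prodState (update (update (fun _ => (1 : Mat d)) v (Matrix.single j l 1)) u X) * ρ).trace -
      (prodState (update (update (fun _ => (1 : Mat d)) v (Matrix.single j l 1)) u X) *
        sigm ρ (bU d) m).trace‖ ≤ Lam d * ∑ β, DD ρ (bU d) m u v X β := by
  have key : ∀ β : BI d,
      ‖(prodState (update (update (fun _ => (1 : Mat d)) v (bX d β)) u X) * ρ).trace -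
      (prodState (update (update (fun _ => (1 : Mat d)) v (bX d β)) u X) *
        sigm ρ (bU d) m).trace‖ ≤ Lam d * ∑ β, DD ρ (bU d) m u v X β := by
    intro β
    refine (diff_le hd (bU_unit d) hρ huv hu hv X (bX d β) β (fun y => (eV (bX d β) y : ℂ))
      (eU_sum (bX_herm d β)) (Lam d) (eV_le d β)).trans ?_
    refine mul_le_mul_of_nonneg_left ?_ (Lam_nonneg d)
    exact Finset.single_le_sum (f := fun β => DD ρ (bU d) m u v X β)
      (fun β _ => DD_nonneg _ _ _ _) (Finset.mem_univ β)
  simp only [← Lf_apply, update_comm huv.symm] at key ⊢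
  have e : ∀ τ : Matrix (Cfg n d) (Cfg n d) ℂ,
      Lf τ (update (update (fun _ => (1 : Mat d)) u X) v (Matrix.single j l 1)) =
      (1 / 2 : ℂ) * Lf τ (update (update (fun _ => (1 : Mat d)) u X) v (bX d (j, l, false))) +
      (-(Complex.I / 2)) *
        Lf τ (update (update (fun _ => (1 : Mat d)) u X) v (bX d (j, l, true))) := by
    intro τ
    rw [single_eq, MultilinearMap.map_update_add, MultilinearMap.map_update_smul,
      MultilinearMap.map_update_smul, smul_eq_mul, smul_eq_mul]
  rw [e, e]
  have k1 := key (j, l, false)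
  have k2 := key (j, l, true)
  set a := Lf ρ (update (update (fun _ => (1 : Mat d)) u X) v (bX d (j, l, false)))
  set b := Lf ρ (update (update (fun _ => (1 : Mat d)) u X) v (bX d (j, l, true)))
  set a' := Lf (sigm ρ (bU d) m) (update (update (fun _ => (1 : Mat d)) u X) v (bX d (j, l, false)))
  set b' := Lf (sigm ρ (bU d) m) (update (update (fun _ => (1 : Mat d)) u X) v (bX d (j, l, true)))
  have : (1 / 2 : ℂ) * a + (-(Complex.I / 2)) * b - ((1 / 2 : ℂ) * a' + (-(Complex.I / 2)) * b') =
      (1 / 2 : ℂ) * (a - a') + (-(Complex.I / 2)) * (b - b') := by ring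
  rw [this]
  refine (norm_add_le _ _).trans ?_
  rw [norm_mul, norm_mul]
  have h1 : ‖(1 / 2 : ℂ)‖ = 1 / 2 := by norm_num
  have h2 : ‖(-(Complex.I / 2))‖ = 1 / 2 := by simp
  rw [h1, h2]
  linarith

lemma prodState_two {u v : Fin n} (huv : u ≠ v) (X Y : Mat d) (x y : Cfg n d) :
    prodState (update (update (fun _ => (1 : Mat d)) v Y) u X) x y =
      (if ∀ w ∉ ({u, v} : Finset (Fin n)), x w = y w then (1 : ℂ) else 0) *
        (X (x u) (y u) * Y (x v) (y v)) := by
  unfold prodState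
  rw [← Finset.mul_prod_erase Finset.univ _ (Finset.mem_univ u),
    ← Finset.mul_prod_erase (Finset.univ.erase u) _ (a := v)
      (Finset.mem_erase.mpr ⟨huv.symm, Finset.mem_univ v⟩)]
  rw [update_self, update_of_ne huv.symm, update_self]
  have : ∏ w ∈ (Finset.univ.erase u).erase v,
      update (update (fun _ => (1 : Mat d)) v Y) u X w (x w) (y w) =
      if ∀ w ∉ ({u, v} : Finset (Fin n)), x w = y w then (1 : ℂ) else 0 := by
    rw [Finset.prod_congr rfl (g := fun w => if x w = y w then (1 : ℂ) else 0)]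
    · rw [Finset.prod_ite_zero]
      simp only [Finset.prod_const_one]
      refine if_congr ?_ rfl rfl
      refine forall_congr' fun w => ?_
      simp only [Finset.mem_erase, Finset.mem_univ, and_true, Finset.mem_insert,
        Finset.mem_singleton, not_or]
      tauto
    · intro w hw
      simp only [Finset.mem_erase, Finset.mem_univ, and_true] at hw
      rw [update_of_ne hw.2, update_of_ne hw.1, Matrix.one_apply]
  rw [this]; ring

lemma decomp {A : Matrix (Cfg n d) (Cfg n d) ℂ} {u v : Fin n} (huv : u ≠ v)
    (hA : ActsOn A {u, v}) (b : Cfg n d) :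
    A = ∑ p : Fin d × Fin d, ∑ q : Fin d × Fin d,
      A (update (update b v q.1) u p.1) (update (update b v q.2) u p.2) •
        prodState (update (update (fun _ => (1 : Mat d)) v (Matrix.single q.1 q.2 1)) u
          (Matrix.single p.1 p.2 1)) := by
  ext x y
  simp only [Matrix.sum_apply, Matrix.smul_apply, prodState_two huv, smul_eq_mul]
  rw [Finset.sum_eq_single (x u, y u), Finset.sum_eq_single (x v, y v)]
  · simp only [Matrix.single_apply_same, mul_one]
    obtain ⟨M, hM⟩ := hA
    rw [hM, hM]
    rw [if_pos (c := ∀ w ∉ ({u, v} : Finset (Fin n)), update (update b v (x v)) u (x u) w =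
      update (update b v (y v)) u (y u) w), one_mul, mul_comm]
    · congr 2
      · ext ⟨w, hw⟩
        simp only [Finset.mem_insert, Finset.mem_singleton] at hw
        rcases hw with rfl | rfl
        · simp
        · simp [update_of_ne huv.symm]
      · ext ⟨w, hw⟩
        simp only [Finset.mem_insert, Finset.mem_singleton] at hw
        rcases hw with rfl | rfl
        · simp
        · simp [update_of_ne huv.symm]
    · intro w hw
      simp only [Finset.mem_insert, Finset.mem_singleton, not_or] at hw
      rw [update_of_ne hw.1, update_of_ne hw.1, update_of_ne hw.2, update_of_ne hw.2]
  · intro q _ hq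
    have : Matrix.single q.1 q.2 (1 : ℂ) (x v) (y v) = 0 := by
      rw [Matrix.single_apply, if_neg]
      rintro ⟨h1, h2⟩
      exact hq (Prod.ext h1 h2)
    rw [this]; ring
  · simp
  · intro p _ hp
    refine Finset.sum_eq_zero fun q _ => ?_
    have : Matrix.single p.1 p.2 (1 : ℂ) (x u) (y u) = 0 := by
      rw [Matrix.single_apply, if_neg]
      rintro ⟨h1, h2⟩
      exact hp (Prod.ext h1 h2)
    rw [this]; ring
  · simp

/-- total correlation between two sites -/
def Wc (ρ : Matrix (Cfg n d) (Cfg n d) ℂ) (m : Fin n → Option (BI d)) (u v : Fin n) : ℝ :=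
  ∑ p : Fin d × Fin d, ∑ β : BI d, DD ρ (bU d) m u v (Matrix.single p.1 p.2 1) β

lemma Wc_nonneg (u v : Fin n) : 0 ≤ Wc ρ m u v :=
  Finset.sum_nonneg fun _ _ => Finset.sum_nonneg fun _ _ => DD_nonneg _ _ _ _

lemma energy_diff (hd : 0 < d) (hρ : IsDensity ρ) {A : Matrix (Cfg n d) (Cfg n d) ℂ}
    {u v : Fin n} (huv : u ≠ v) (hA : ActsOn A {u, v}) (hu : m u = none) (hv : m v = none) :
    |energy A ρ - energy A (sigm ρ (bU d) m)| ≤ opNorm A * ((d : ℝ) ^ 2 * Lam d * Wc ρ m u v) := by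
  have e : ∀ τ : Matrix (Cfg n d) (Cfg n d) ℂ, (A * τ).trace =
      ∑ p : Fin d × Fin d, ∑ q : Fin d × Fin d,
      A (update (update (fun _ => ⟨0, hd⟩) v q.1) u p.1)
        (update (update (fun _ => ⟨0, hd⟩) v q.2) u p.2) *
        (prodState (update (update (fun _ => (1 : Mat d)) v (Matrix.single q.1 q.2 1)) u
          (Matrix.single p.1 p.2 1)) * τ).trace := by
    intro τ
    conv_lhs => rw [decomp huv hA (fun _ => ⟨0, hd⟩)]
    simp only [Finset.sum_mul, Matrix.trace_sum, Matrix.smul_mul, Matrix.trace_smul, smul_eq_mul]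
  unfold energy
  rw [← Complex.sub_re]
  refine (Complex.abs_re_le_norm _).trans ?_
  rw [e, e, ← Finset.sum_sub_distrib]
  simp only [← Finset.sum_sub_distrib, ← mul_sub]
  refine (norm_sum_le _ _).trans ?_
  have hp : ∀ p ∈ (Finset.univ : Finset (Fin d × Fin d)), ‖∑ q : Fin d × Fin d,
      A (update (update (fun _ => ⟨0, hd⟩) v q.1) u p.1)
        (update (update (fun _ => ⟨0, hd⟩) v q.2) u p.2) *
        ((prodState (update (update (fun _ => (1 : Mat d)) v (Matrix.single q.1 q.2 1)) u
          (Matrix.single p.1 p.2 1)) * ρ).trace -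
        (prodState (update (update (fun _ => (1 : Mat d)) v (Matrix.single q.1 q.2 1)) u
          (Matrix.single p.1 p.2 1)) * sigm ρ (bU d) m).trace)‖ ≤
      opNorm A * ((d : ℝ) ^ 2 * Lam d * ∑ β, DD ρ (bU d) m u v (Matrix.single p.1 p.2 1) β) := by
    intro p _
    refine (norm_sum_le _ _).trans ?_
    have hq : ∀ q ∈ (Finset.univ : Finset (Fin d × Fin d)),
      ‖A (update (update (fun _ => ⟨0, hd⟩) v q.1) u p.1)
        (update (update (fun _ => ⟨0, hd⟩) v q.2) u p.2) *
        ((prodState (update (update (fun _ => (1 : Mat d)) v (Matrix.single q.1 q.2 1)) u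
          (Matrix.single p.1 p.2 1)) * ρ).trace -
        (prodState (update (update (fun _ => (1 : Mat d)) v (Matrix.single q.1 q.2 1)) u
          (Matrix.single p.1 p.2 1)) * sigm ρ (bU d) m).trace)‖ ≤
        opNorm A * (Lam d * ∑ β, DD ρ (bU d) m u v (Matrix.single p.1 p.2 1) β) := by
      intro q _
      rw [norm_mul]
      exact mul_le_mul (entry_le _ _ _) (diff_single hd hρ huv hu hv _ _ _) (norm_nonneg _)
        (opNorm_nonneg _)
    refine (Finset.sum_le_sum hq).trans (le_of_eq ?_)
    rw [Finset.sum_const, Finset.card_univ, Fintype.card_prod, Fintype.card_fin, nsmul_eq_mul]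
    push_cast; ring
  refine (Finset.sum_le_sum hp).trans (le_of_eq ?_)
  unfold Wc
  simp only [Finset.mul_sum]

end Basis

section Avg

open Function

variable {n : ℕ} {B : Type*} [Fintype B]

/-- one random measurement step -/
def Tav (n : ℕ) (B : Type*) [Fintype B] :
    ((Fin n → Option B) → ℝ) →ₗ[ℝ] ((Fin n → Option B) → ℝ) where
  toFun g := fun m => ((n : ℝ) * Fintype.card B)⁻¹ * ∑ v, ∑ β, g (step m v β)
  map_add' f g := by
    funext m
    simp only [Pi.add_apply, Finset.sum_add_distrib, mul_add]
  map_smul' c g := by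
    funext m
    simp only [Pi.smul_apply, smul_eq_mul, RingHom.id_apply, ← Finset.mul_sum]
    ring

lemma Tav_apply (g : (Fin n → Option B) → ℝ) (m : Fin n → Option B) :
    Tav n B g m = ((n : ℝ) * Fintype.card B)⁻¹ * ∑ v, ∑ β, g (step m v β) := rfl

/-- expectation after some number of random measurement steps -/
def Eav (n : ℕ) (B : Type*) [Fintype B] : ℕ → (((Fin n → Option B) → ℝ) →ₗ[ℝ] ℝ)
  | 0 => LinearMap.proj (fun _ => none)
  | j + 1 => (Eav n B j).comp (Tav n B)

lemma Eav_succ (j : ℕ) (g : (Fin n → Option B) → ℝ) :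
    Eav n B (j + 1) g = Eav n B j (Tav n B g) := rfl

lemma Tav_mono {f g : (Fin n → Option B) → ℝ} (h : ∀ m, f m ≤ g m) (m : Fin n → Option B) :
    Tav n B f m ≤ Tav n B g m := by
  rw [Tav_apply, Tav_apply]
  refine mul_le_mul_of_nonneg_left ?_ (by positivity)
  exact Finset.sum_le_sum fun v _ => Finset.sum_le_sum fun β _ => h _

lemma Eav_mono (j : ℕ) : ∀ {f g : (Fin n → Option B) → ℝ}, (∀ m, f m ≤ g m) →
    Eav n B j f ≤ Eav n B j g := by
  induction j with
  | zero => intro f g h; exact h _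
  | succ j ih => intro f g h; exact ih (Tav_mono h)

lemma Tav_const (hn : 0 < n) [Nonempty B] (c : ℝ) : Tav n B (fun _ => c) = fun _ => c := by
  funext m
  have h1 : (n : ℝ) ≠ 0 := by exact_mod_cast hn.ne'
  have h2 : (Fintype.card B : ℝ) ≠ 0 := by exact_mod_cast Fintype.card_ne_zero
  rw [Tav_apply]
  simp only [Finset.sum_const, Finset.card_univ, Fintype.card_fin, nsmul_eq_mul]
  field_simp

lemma Eav_const (hn : 0 < n) [Nonempty B] (c : ℝ) (j : ℕ) : Eav n B j (fun _ => c) = c := by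
  induction j with
  | zero => rfl
  | succ j ih => rw [Eav_succ, Tav_const hn, ih]

/-- indicator that a site was measured -/
def Ind (u : Fin n) (m : Fin n → Option B) : ℝ := if m u = none then 0 else 1

lemma Ind_nonneg (u : Fin n) (m : Fin n → Option B) : 0 ≤ Ind u m := by
  unfold Ind; split_ifs <;> norm_num

lemma Ind_step (u v : Fin n) (β : B) (m : Fin n → Option B) :
    Ind u (step m v β) ≤ Ind u m + if v = u then 1 else 0 := by
  by_cases hv : v = u
  · subst hv
    rw [if_pos rfl]
    have := Ind_nonneg v m
    have h1 : Ind v (step m v β) ≤ 1 := by unfold Ind; split_ifs <;> norm_num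
    linarith
  · rw [if_neg hv, add_zero]
    unfold step
    split_ifs
    · unfold Ind; rw [update_of_ne (Ne.symm hv)]
    · exact le_rfl

lemma Tav_Ind (hn : 0 < n) [Nonempty B] (u : Fin n) (m : Fin n → Option B) :
    Tav n B (Ind u) m ≤ Ind u m + 1 / n := by
  have h1 : (0 : ℝ) < n := by exact_mod_cast hn
  have h2 : (0 : ℝ) < Fintype.card B := by exact_mod_cast Fintype.card_pos
  rw [Tav_apply, inv_mul_le_iff₀ (by positivity)]
  refine (Finset.sum_le_sum fun v _ => Finset.sum_le_sum fun β _ => Ind_step u v β m).trans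
    (le_of_eq ?_)
  simp only [Finset.sum_const, Finset.card_univ, nsmul_eq_mul, ← Finset.mul_sum,
    Finset.sum_add_distrib, Finset.sum_ite_eq', Finset.mem_univ, if_true, Fintype.card_fin]
  field_simp

lemma Eav_Ind (hn : 0 < n) [Nonempty B] (u : Fin n) (j : ℕ) :
    Eav n B j (Ind u) ≤ (j : ℝ) / n := by
  induction j with
  | zero => simp [Eav, Ind]
  | succ j ih =>
    rw [Eav_succ]
    refine (Eav_mono j (g := Ind u + fun _ => (1 / n : ℝ)) (Tav_Ind hn u)).trans ?_
    rw [map_add, Eav_const hn]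
    push_cast
    rw [add_div]
    linarith

lemma Eav_tele (hn : 0 < n) [Nonempty B] (G Ψ : (Fin n → Option B) → ℝ) (c K : ℝ) (hc : 0 ≤ c)
    (h0 : ∀ m, 0 ≤ Ψ m) (h1 : ∀ m, Ψ m ≤ K)
    (hG : ∀ m, G m ≤ c * ∑ v, ∑ β, (Ψ (step m v β) - Ψ m)) (l : ℕ) :
    ∑ j ∈ Finset.range l, Eav n B j G ≤ c * (n * Fintype.card B) * K := by
  have h1' : (n : ℝ) ≠ 0 := by exact_mod_cast hn.ne'
  have h2' : (Fintype.card B : ℝ) ≠ 0 := by exact_mod_cast Fintype.card_ne_zero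
  have hG' : ∀ m, G m ≤ ((c * (n * Fintype.card B)) • (Tav n B Ψ - Ψ)) m := by
    intro m
    refine (hG m).trans (le_of_eq ?_)
    simp only [Pi.smul_apply, Pi.sub_apply, smul_eq_mul, Tav_apply, Finset.sum_sub_distrib,
      Finset.sum_const, Finset.card_univ, Fintype.card_fin, nsmul_eq_mul]
    field_simp
  have h3 : ∀ j, Eav n B j G ≤
      c * (n * Fintype.card B) * (Eav n B (j + 1) Ψ - Eav n B j Ψ) := by
    intro j
    refine (Eav_mono j hG').trans (le_of_eq ?_)
    rw [map_smul, map_sub, smul_eq_mul, Eav_succ]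
  refine (Finset.sum_le_sum fun j _ => h3 j).trans ?_
  rw [← Finset.mul_sum, Finset.sum_range_sub (fun j => Eav n B j Ψ)]
  refine mul_le_mul_of_nonneg_left ?_ (by positivity)
  have a1 : Eav n B l Ψ ≤ K := (Eav_mono l h1).trans (Eav_const hn K l).le
  have a2 : 0 ≤ Eav n B 0 Ψ := h0 _
  linarith

lemma Eav_exists (hn : 0 < n) [Nonempty B] (R : (Fin n → Option B) → ℝ) (M : ℝ) (l : ℕ)
    (hl : 0 < l) (h : ∑ j ∈ Finset.range l, Eav n B j R ≤ l * M) : ∃ m, R m ≤ M := by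
  obtain ⟨m₀, hm₀⟩ := Finite.exists_min R
  refine ⟨m₀, ?_⟩
  have h1 : ∀ j ∈ Finset.range l, R m₀ ≤ Eav n B j R := fun j _ =>
    (Eav_const hn (R m₀) j).ge.trans (Eav_mono j hm₀)
  have h2 := (Finset.sum_le_sum h1).trans h
  rw [Finset.sum_const, Finset.card_range, nsmul_eq_mul] at h2
  exact le_of_mul_le_mul_left h2 (by exact_mod_cast hl)

end Avg

section Pot

open Matrix Function

variable {n d : ℕ} {ρ : Matrix (Cfg n d) (Cfg n d) ℂ}

/-- bound for the potential of one site -/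
def Kd (d : ℕ) : ℝ := ∑ p : Fin d × Fin d, opNorm (Matrix.single p.1 p.2 1 : Mat d) ^ 2

lemma Kd_nonneg (d : ℕ) : 0 ≤ Kd d := Finset.sum_nonneg fun _ _ => sq_nonneg _

/-- total potential -/
def Psi (ρ : Matrix (Cfg n d) (Cfg n d) ℂ) (m : Fin n → Option (BI d)) : ℝ :=
  ∑ u, ∑ p : Fin d × Fin d, Phi ρ (bU d) u (Matrix.single p.1 p.2 1) m

lemma Psi_nonneg (hρ : IsDensity ρ) (m : Fin n → Option (BI d)) : 0 ≤ Psi ρ m :=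
  Finset.sum_nonneg fun _ _ => Finset.sum_nonneg fun _ _ => Phi_nonneg hρ _ _

lemma Psi_le (hd : 0 < d) (hρ : IsDensity ρ) (m : Fin n → Option (BI d)) :
    Psi ρ m ≤ n * Kd d := by
  refine (Finset.sum_le_sum fun u _ => Finset.sum_le_sum fun p _ =>
    Phi_le hd (bU_unit d) hρ u _).trans (le_of_eq ?_)
  rw [Finset.sum_const, Finset.card_univ, Fintype.card_fin, nsmul_eq_mul]
  rfl

/-- correlation of an unmeasured pair -/
def Dv (ρ : Matrix (Cfg n d) (Cfg n d) ℂ) (m : Fin n → Option (BI d)) (u v : Fin n) : ℝ :=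
  if u ≠ v ∧ m u = none ∧ m v = none then Wc ρ m u v else 0

lemma Dv_nonneg (m : Fin n → Option (BI d)) (u v : Fin n) : 0 ≤ Dv ρ m u v := by
  unfold Dv; split_ifs
  · exact Wc_nonneg _ _
  · exact le_rfl

/-- Cauchy-Schwarz constant -/
def cS (d : ℕ) : ℝ := Fintype.card ((Fin d × Fin d) × BI d)

lemma Dv_sq (hd : 0 < d) (hρ : IsDensity ρ) (m : Fin n → Option (BI d)) (u v : Fin n) :
    Dv ρ m u v ^ 2 ≤ cS d * ∑ β, ∑ p : Fin d × Fin d,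
      (Phi ρ (bU d) u (Matrix.single p.1 p.2 1) (step m v β) -
        Phi ρ (bU d) u (Matrix.single p.1 p.2 1) m) := by
  unfold Dv
  split_ifs with h
  · obtain ⟨huv, hu, hv⟩ := h
    unfold Wc
    rw [← Fintype.sum_prod_type' (fun (p : Fin d × Fin d) (β : BI d) =>
      DD ρ (bU d) m u v (Matrix.single p.1 p.2 1) β)]
    refine (sq_sum_le_card_mul_sum_sq).trans ?_
    rw [Finset.card_univ]
    refine mul_le_mul_of_nonneg_left ?_ (Nat.cast_nonneg _)
    rw [Finset.sum_comm, ← Fintype.sum_prod_type' (fun (p : Fin d × Fin d) (β : BI d) =>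
      (Phi ρ (bU d) u (Matrix.single p.1 p.2 1) (step m v β) -
        Phi ρ (bU d) u (Matrix.single p.1 p.2 1) m))]
    exact Finset.sum_le_sum fun x _ => DD_le hd (bU_unit d) hρ huv hu hv _ _
  · rw [zero_pow two_ne_zero]
    refine mul_nonneg (Nat.cast_nonneg _) (Finset.sum_nonneg fun β _ => Finset.sum_nonneg fun p _ => ?_)
    exact sub_nonneg.mpr (Phi_mono hd (bU_unit d) hρ _ _ _ _)

/-- total squared correlation -/
def Gt (ρ : Matrix (Cfg n d) (Cfg n d) ℂ) (m : Fin n → Option (BI d)) : ℝ :=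
  ∑ q : Fin n × Fin n, Dv ρ m q.1 q.2 ^ 2

lemma Gt_le (hd : 0 < d) (hρ : IsDensity ρ) (m : Fin n → Option (BI d)) :
    Gt ρ m ≤ cS d * ∑ v, ∑ β, (Psi ρ (step m v β) - Psi ρ m) := by
  unfold Gt
  rw [Fintype.sum_prod_type_right' (fun u v => Dv ρ m u v ^ 2)]
  refine (Finset.sum_le_sum fun v _ => Finset.sum_le_sum fun u _ => Dv_sq hd hρ m u v).trans
    (le_of_eq ?_)
  rw [Finset.mul_sum]
  refine Finset.sum_congr rfl fun v _ => ?_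
  rw [← Finset.mul_sum, Finset.sum_comm]
  simp only [Psi, Finset.sum_sub_distrib]

end Pot

section Final

open Matrix Function

variable {n d : ℕ} {ρ : Matrix (Cfg n d) (Cfg n d) ℂ}

/-- pair constant -/
def c3 (d : ℕ) : ℝ := (d : ℝ) ^ 2 * Lam d

lemma c3_nonneg (d : ℕ) : 0 ≤ c3 d := mul_nonneg (by positivity) (Lam_nonneg d)

lemma term_le (hd : 0 < d) (hρ : IsDensity ρ) {A : Matrix (Cfg n d) (Cfg n d) ℂ}
    {u v : Fin n} (huv : u ≠ v) (hA : ActsOn A {u, v}) (m : Fin n → Option (BI d)) :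
    energy A (sigm ρ (bU d) m) - energy A ρ ≤
      2 * opNorm A * (Ind u m + Ind v m) + c3 d * (opNorm A * Dv ρ m u v) := by
  have hJ := opNorm_nonneg A
  have h0 : 0 ≤ c3 d * (opNorm A * Dv ρ m u v) :=
    mul_nonneg (c3_nonneg d) (mul_nonneg hJ (Dv_nonneg _ _ _))
  have hu0 := Ind_nonneg u m
  have hv0 := Ind_nonneg v m
  by_cases h : m u = none ∧ m v = none
  · have h1 := energy_diff hd hρ huv hA h.1 h.2
    have h2 := neg_abs_le (energy A ρ - energy A (sigm ρ (bU d) m))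
    have h3 : Dv ρ m u v = Wc ρ m u v := by unfold Dv; rw [if_pos ⟨huv, h⟩]
    rw [h3]
    have h4 : 0 ≤ 2 * opNorm A * (Ind u m + Ind v m) := by positivity
    have h5 : c3 d * (opNorm A * Wc ρ m u v) = opNorm A * ((d : ℝ) ^ 2 * Lam d * Wc ρ m u v) := by
      unfold c3; ring
    linarith
  · have h1 : 1 ≤ Ind u m + Ind v m := by
      rw [not_and_or] at h
      rcases h with h | h
      · have : Ind u m = 1 := by unfold Ind; rw [if_neg h]
        linarith
      · have : Ind v m = 1 := by unfold Ind; rw [if_neg h]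
        linarith
    have h2 := abs_le.mp (energy_le A ρ hρ)
    have h3 := abs_le.mp (energy_le A _ (sigm_density (m := m) hd (bU_unit d) hρ u))
    nlinarith [mul_le_mul_of_nonneg_left h1 hJ]

lemma energy_sum {ι : Type*} (E : Finset ι) (h : ι → Matrix (Cfg n d) (Cfg n d) ℂ)
    (τ : Matrix (Cfg n d) (Cfg n d) ℂ) : energy (∑ e ∈ E, h e) τ = ∑ e ∈ E, energy (h e) τ := by
  unfold energy
  rw [Finset.sum_mul, Matrix.trace_sum, Complex.re_sum]

lemma amgm (G s N : ℝ) (hG : 0 ≤ G) (hs : 0 < s) (hN : 0 < N) :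
    Real.sqrt G ≤ 1 / 2 * (G * (s / N) + N / s) := by
  have h1 := Real.sq_sqrt hG
  set g := Real.sqrt G
  rw [← h1]
  have h2 : 1 / 2 * (g ^ 2 * (s / N) + N / s) - g = (g * s - N) ^ 2 / (2 * N * s) := by
    field_simp; ring
  have h3 : 0 ≤ (g * s - N) ^ 2 / (2 * N * s) := by positivity
  linarith

lemma main_avg (hd : 0 < d) (hρ : IsDensity ρ) (E : Finset (Finset (Fin n)))
    (h : Finset (Fin n) → Matrix (Cfg n d) (Cfg n d) ℂ)
    (hE : ∀ e ∈ E, e.card = 2) (hA : ∀ e ∈ E, ActsOn (h e) e) (l : ℕ) (hl : 1 ≤ l) (hln : l ≤ n) :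
    ∃ m : Fin n → Option (BI d),
      energy (∑ e ∈ E, h e) (sigm ρ (bU d) m) - energy (∑ e ∈ E, h e) ρ ≤
      4 * ((l : ℝ) / n) * (∑ e ∈ E, opNorm (h e)) +
        c3 d / 2 * (cS d * Fintype.card (BI d) * Kd d + 1) *
          (((n : ℝ) / Real.sqrt l) * Real.sqrt (∑ e ∈ E, (opNorm (h e)) ^ 2)) := by
  have hn : 0 < n := lt_of_lt_of_le hl hln
  have : Nonempty (BI d) := ⟨(⟨0, hd⟩, ⟨0, hd⟩, true)⟩
  have hab : ∀ e : Finset (Fin n), ∃ q : Fin n × Fin n, e ∈ E → q.1 ≠ q.2 ∧ e = {q.1, q.2} := by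
    intro e
    by_cases he : e ∈ E
    · obtain ⟨a, b, hab, rfl⟩ := Finset.card_eq_two.mp (hE e he)
      exact ⟨(a, b), fun _ => ⟨hab, rfl⟩⟩
    · exact ⟨(⟨0, hn⟩, ⟨0, hn⟩), fun h => absurd h he⟩
  choose q hq using hab
  have hNr : (0 : ℝ) < n := by exact_mod_cast hn
  have hlr : (0 : ℝ) < l := by exact_mod_cast hl
  have hs : 0 < Real.sqrt l := Real.sqrt_pos.mpr hlr
  have hss : Real.sqrt l * Real.sqrt l = l := Real.mul_self_sqrt hlr.le
  set s := Real.sqrt l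
  set JF := Real.sqrt (∑ e ∈ E, (opNorm (h e)) ^ 2)
  have hJF : 0 ≤ JF := Real.sqrt_nonneg _
  set R : (Fin n → Option (BI d)) → ℝ :=
    (∑ e ∈ E, (2 * opNorm (h e)) • (Ind (q e).1 + Ind (q e).2)) +
      (c3 d * JF / 2 * (s / n)) • Gt ρ + fun _ => c3 d * JF / 2 * (n / s) with hR
  have hRle : ∀ m, energy (∑ e ∈ E, h e) (sigm ρ (bU d) m) - energy (∑ e ∈ E, h e) ρ ≤ R m := by
    intro m
    rw [energy_sum, energy_sum, ← Finset.sum_sub_distrib]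
    have h1 : ∀ e ∈ E, energy (h e) (sigm ρ (bU d) m) - energy (h e) ρ ≤
        2 * opNorm (h e) * (Ind (q e).1 m + Ind (q e).2 m) +
          c3 d * (opNorm (h e) * Dv ρ m (q e).1 (q e).2) := by
      intro e he
      have h2 := hA e he
      obtain ⟨h3, h4⟩ := hq e he
      rw [h4] at h2
      rw [← h4] at h2
      refine term_le hd hρ h3 ?_ m
      rw [← h4]; exact h2
    refine (Finset.sum_le_sum h1).trans ?_
    rw [Finset.sum_add_distrib, ← Finset.mul_sum]
    have cs : ∑ e ∈ E, opNorm (h e) * Dv ρ m (q e).1 (q e).2 ≤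
        JF * Real.sqrt (∑ e ∈ E, Dv ρ m (q e).1 (q e).2 ^ 2) :=
      Real.sum_mul_le_sqrt_mul_sqrt _ _ _
    have inj : Set.InjOn q (E : Set (Finset (Fin n))) := by
      intro e he e' he' hee
      rw [(hq e he).2, (hq e' he').2, hee]
    have hG : ∑ e ∈ E, Dv ρ m (q e).1 (q e).2 ^ 2 ≤ Gt ρ m := by
      rw [← Finset.sum_image (f := fun p : Fin n × Fin n => Dv ρ m p.1 p.2 ^ 2) inj]
      exact Finset.sum_le_univ_sum_of_nonneg fun p => sq_nonneg _
    have hG0 : 0 ≤ Gt ρ m := Finset.sum_nonneg fun _ _ => sq_nonneg _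
    have h5 : ∑ e ∈ E, opNorm (h e) * Dv ρ m (q e).1 (q e).2 ≤
        JF * (1 / 2 * (Gt ρ m * (s / n) + n / s)) :=
      cs.trans (mul_le_mul_of_nonneg_left
        ((Real.sqrt_le_sqrt hG).trans (amgm _ _ _ hG0 hs hNr)) hJF)
    have h6 := mul_le_mul_of_nonneg_left h5 (c3_nonneg d)
    simp only [hR, Pi.add_apply, Finset.sum_apply, Pi.smul_apply, smul_eq_mul]
    rw [add_assoc]
    refine add_le_add le_rfl (h6.trans (le_of_eq ?_))
    ring
  have hb : ∑ j ∈ Finset.range l, Eav n (BI d) j R ≤ l * (4 * ((l : ℝ) / n) *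
      (∑ e ∈ E, opNorm (h e)) + c3 d / 2 * (cS d * Fintype.card (BI d) * Kd d + 1) *
          (((n : ℝ) / s) * JF)) := by
    have t1 := Eav_tele hn (Gt ρ) (Psi ρ) (cS d) (n * Kd d) (Nat.cast_nonneg _)
      (Psi_nonneg hρ) (Psi_le hd hρ) (Gt_le hd hρ) l
    have t2 : ∀ j ∈ Finset.range l, Eav n (BI d) j R ≤
        4 * ((l : ℝ) / n) * (∑ e ∈ E, opNorm (h e)) +
          (c3 d * JF / 2 * (s / n)) * Eav n (BI d) j (Gt ρ) + c3 d * JF / 2 * (n / s) := by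
      intro j hj
      have hjl : (j : ℝ) / n ≤ (l : ℝ) / n := by
        have : (j : ℝ) ≤ l := by exact_mod_cast (Finset.mem_range.mp hj).le
        gcongr
      rw [hR, map_add, map_add, Eav_const hn, map_smul, smul_eq_mul, map_sum]
      refine add_le_add (add_le_add ?_ le_rfl) le_rfl
      rw [Finset.mul_sum]
      refine Finset.sum_le_sum fun e _ => ?_
      rw [map_smul, map_add, smul_eq_mul]
      have i1 := Eav_Ind (B := BI d) hn (q e).1 j
      have i2 := Eav_Ind (B := BI d) hn (q e).2 j
      nlinarith [opNorm_nonneg (h e)]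
    refine (Finset.sum_le_sum t2).trans ?_
    rw [Finset.sum_add_distrib, Finset.sum_add_distrib, Finset.sum_const, Finset.sum_const,
      Finset.card_range, nsmul_eq_mul, nsmul_eq_mul]
    have t3 := mul_le_mul_of_nonneg_left t1
      (show 0 ≤ c3 d * JF / 2 * (s / n) by have := c3_nonneg d; positivity)
    have t4 : c3 d * JF / 2 * (s / n) * (cS d * (n * Fintype.card (BI d)) * (n * Kd d)) =
        l * (c3 d / 2 * (cS d * Fintype.card (BI d) * Kd d) * ((n : ℝ) / s * JF)) := by
      rw [← hss]
      field_simp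
    rw [t4, Finset.mul_sum] at t3
    refine (add_le_add (add_le_add le_rfl t3) le_rfl).trans (le_of_eq ?_)
    ring
  obtain ⟨m, hm⟩ := Eav_exists hn R _ l hl hb
  exact ⟨m, (hRle m).trans hm⟩

end Final

/-- For every fixed local dimension `d` there is a constant `C` such that for
every 2-local Hamiltonian `H` on `n` qudits of local dimension `d` (inverse temperature
absorbed, `β = 1`) and every integer `1 ≤ l ≤ n`, there exists a separable state `σ` with
`f(σ) ≥ F ≥ f(σ) − C·((l/n)·|J|₁ + (n/√l)·‖J‖_F)`, where `J_e = ‖h_e‖_∞`. -/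
theorem separable_state_free_energy_2local :
    ∀ d : ℕ, 0 < d → ∃ C : ℝ, 0 < C ∧
      ∀ (n : ℕ) (E : Finset (Finset (Fin n)))
        (h : Finset (Fin n) → Matrix (Fin n → Fin d) (Fin n → Fin d) ℂ),
        (∀ e ∈ E, e.card = 2) →
        (∀ e ∈ E, (h e).IsHermitian) →
        (∀ e ∈ E, ActsOn (h e) e) →
        ∀ l : ℕ, 1 ≤ l → l ≤ n →
        ∃ σ : Matrix (Fin n → Fin d) (Fin n → Fin d) ℂ, IsSeparable σ ∧
          freeEnergy 1 (∑ e ∈ E, h e) ≤ freeEnergyFun 1 (∑ e ∈ E, h e) σ ∧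
          freeEnergyFun 1 (∑ e ∈ E, h e) σ -
              C * (((l : ℝ) / n) * (∑ e ∈ E, opNorm (h e)) +
                ((n : ℝ) / Real.sqrt l) * Real.sqrt (∑ e ∈ E, (opNorm (h e)) ^ 2)) ≤
            freeEnergy 1 (∑ e ∈ E, h e) := by
  intro d hd
  have hc2 : 0 ≤ c3 d / 2 * (cS d * Fintype.card (BI d) * Kd d + 1) := by
    have h1 := c3_nonneg d
    have h2 : 0 ≤ cS d := Nat.cast_nonneg _
    have h3 := Kd_nonneg d
    positivity
  refine ⟨4 + c3 d / 2 * (cS d * Fintype.card (BI d) * Kd d + 1), by positivity, ?_⟩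
  intro n E h hE hH hA l hl hln
  have hn : 0 < n := lt_of_lt_of_le hl hln
  have : Nonempty (Fin n → Fin d) := ⟨fun _ => ⟨0, hd⟩⟩
  have hHH : (∑ e ∈ E, h e).IsHermitian := by
    unfold Matrix.IsHermitian
    rw [Matrix.conjTranspose_sum]
    exact Finset.sum_congr rfl fun e he => hH e he
  obtain ⟨ρ, hρ, hmin⟩ := gibbs (∑ e ∈ E, h e) hHH
  obtain ⟨m, hm⟩ := main_avg hd hρ E h hE hA l hl hln
  have hσ := sigm_density (m := m) hd (bU_unit d) hρ ⟨0, hn⟩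
  have hF : freeEnergyFun 1 (∑ e ∈ E, h e) ρ ≤ freeEnergy 1 (∑ e ∈ E, h e) := by
    refine le_csInf ⟨_, ρ, hρ, rfl⟩ ?_
    rintro _ ⟨ω, hω, rfl⟩
    exact hmin ω hω
  refine ⟨sigm ρ (bU d) m, sigm_sep hd (bU_unit d) hρ ⟨0, hn⟩, ?_, ?_⟩
  · refine csInf_le ⟨freeEnergyFun 1 (∑ e ∈ E, h e) ρ, ?_⟩ ⟨_, hσ, rfl⟩
    rintro _ ⟨ω, hω, rfl⟩
    exact hmin ω hω
  · refine le_trans ?_ hF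
    have hent := entropy_ge (m := m) hd (bU_unit d) hρ ⟨0, hn⟩
    unfold freeEnergyFun
    have p1 : 0 ≤ ((l : ℝ) / n) * (∑ e ∈ E, opNorm (h e)) :=
      mul_nonneg (by positivity) (Finset.sum_nonneg fun _ _ => opNorm_nonneg _)
    have p2 : 0 ≤ ((n : ℝ) / Real.sqrt l) * Real.sqrt (∑ e ∈ E, (opNorm (h e)) ^ 2) := by
      positivity
    have p3 := mul_nonneg hc2 p1
    rw [div_one, div_one]
    linarith

end QLH
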